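/- Let Q(x) = 3 sech²(x/2), so that u(t,x) = Q(x−t) is a solitary-wave solution of the KdV equation u_t + u u_x + u_{xxx} = 0. Then for every ε > 0 there exists δ > 0 such that for every smooth solution u : ℝ × ℝ → ℝ of the KdV equation which is Schwartz in x for each fixed t, if ‖u(0,·) − Q‖_{H¹(ℝ)} < δ then sup_{t ∈ ℝ} inf_{a ∈ ℝ} ‖u(t,·) − Q(· − a)‖_{H¹(ℝ)} < ε. -/

import Mathlib

open MeasureTheory

/-- The KdV soliton profile `Q(x) = 3 sech²(x/2)`. -/
noncomputable def Q (x : ℝ) : ℝ := 3 * (1 / Real.cosh (x / 2)) ^ 2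

/-- The squared `H¹(ℝ)` norm, `‖f‖_{H¹}² = ∫ (|f|² + |f'|²)`. -/
noncomputable def H1normSq (f : ℝ → ℝ) : ℝ := ∫ x : ℝ, ((f x) ^ 2 + (deriv f x) ^ 2)

open MeasureTheory

open Filter Topology Set

/-- Continuous functions with quadratic decay. -/
def Dec (f : ℝ → ℝ) : Prop := Continuous f ∧ ∃ C : ℝ, ∀ x, |f x| * (1 + x ^ 2) ≤ C

namespace Dec

variable {f g : ℝ → ℝ}

lemma cont (hf : Dec f) : Continuous f := hf.1

lemma bdd (hf : Dec f) : ∃ C : ℝ, 0 ≤ C ∧ ∀ x, |f x| ≤ C := by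
  obtain ⟨_, C, hC⟩ := hf
  refine ⟨C, (by have := hC 0; have := abs_nonneg (f 0); nlinarith), fun x => ?_⟩
  have := hC x
  have := abs_nonneg (f x)
  nlinarith [mul_nonneg this (sq_nonneg x)]

lemma mul_bdd (hf : Dec f) (hg : Continuous g) {B : ℝ} (hB : ∀ x, |g x| ≤ B) :
    Dec (fun x => f x * g x) := by
  obtain ⟨hc, C, hC⟩ := hf
  refine ⟨hc.mul hg, C * B, fun x => ?_⟩
  rw [abs_mul]
  have h1 := hC x
  have h2 := hB x
  have h3 : 0 ≤ |f x| * (1 + x ^ 2) := by positivity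
  calc |f x| * |g x| * (1 + x ^ 2) = (|f x| * (1 + x ^ 2)) * |g x| := by ring
    _ ≤ C * B := mul_le_mul h1 h2 (abs_nonneg _) (h3.trans h1)

lemma mul (hf : Dec f) (hg : Dec g) : Dec (fun x => f x * g x) := by
  obtain ⟨B, _, hB⟩ := hg.bdd
  exact hf.mul_bdd hg.1 hB

lemma add (hf : Dec f) (hg : Dec g) : Dec (fun x => f x + g x) := by
  obtain ⟨hc, C, hC⟩ := hf
  obtain ⟨hc', C', hC'⟩ := hg
  refine ⟨hc.add hc', C + C', fun x => ?_⟩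
  have := abs_add_le (f x) (g x)
  have := hC x
  have := hC' x
  nlinarith [sq_nonneg x]

lemma const_mul (c : ℝ) (hf : Dec f) : Dec (fun x => c * f x) := by
  have := hf.mul_bdd (g := fun _ => c) continuous_const (B := |c|) (fun _ => le_rfl)
  simpa [mul_comm] using this

lemma mul_const (hf : Dec f) (c : ℝ) : Dec (fun x => f x * c) :=
  hf.mul_bdd (g := fun _ => c) continuous_const (B := |c|) (fun _ => le_rfl)

lemma div_const (hf : Dec f) (c : ℝ) : Dec (fun x => f x / c) := by
  simpa [div_eq_mul_inv] using hf.mul_const c⁻¹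

lemma neg (hf : Dec f) : Dec (fun x => - f x) := by
  simpa using hf.const_mul (-1)

lemma sub (hf : Dec f) (hg : Dec g) : Dec (fun x => f x - g x) := by
  simpa [sub_eq_add_neg] using hf.add hg.neg

lemma sq (hf : Dec f) : Dec (fun x => f x ^ 2) := by
  simpa [pow_two] using hf.mul hf

lemma cube (hf : Dec f) : Dec (fun x => f x ^ 3) := by
  have := hf.mul hf.sq
  refine (funext fun x => ?_ : (fun x => f x ^ 3) = fun x => f x * f x ^ 2) ▸ this
  ring

lemma abs (hf : Dec f) : Dec (fun x => |f x|) := by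
  obtain ⟨hc, C, hC⟩ := hf
  exact ⟨hc.abs, C, fun x => by simpa using hC x⟩

lemma of_le (hg : Dec g) (hf : Continuous f) (h : ∀ x, |f x| ≤ |g x|) : Dec f := by
  obtain ⟨_, C, hC⟩ := hg
  refine ⟨hf, C, fun x => le_trans ?_ (hC x)⟩
  exact mul_le_mul_of_nonneg_right (h x) (by positivity)

lemma le_inv {C : ℝ} (hC : ∀ x, |f x| * (1 + x ^ 2) ≤ C) (x : ℝ) : |f x| ≤ C * (1 + x ^ 2)⁻¹ := by
  rw [← div_eq_mul_inv, le_div_iff₀ (by positivity)]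
  exact hC x

lemma integrable (hf : Dec f) : Integrable f := by
  obtain ⟨hc, C, hC⟩ := hf
  refine (integrable_inv_one_add_sq.const_mul C).mono' hc.aestronglyMeasurable ?_
  exact Eventually.of_forall fun x => le_inv hC x

lemma shift_aux {x s : ℝ} (hs : |s| ≤ 1) : 1 + x ^ 2 ≤ 3 * (1 + (x + s) ^ 2) := by
  have : s ^ 2 ≤ 1 := by simpa using sq_le_sq' (by linarith [neg_abs_le s]) (le_of_abs_le hs)
  nlinarith [sq_nonneg (x + 2 * s)]

lemma shift (hf : Dec f) (a : ℝ) : Dec (fun x => f (x + a)) := by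
  obtain ⟨hc, C, hC⟩ := hf
  refine ⟨hc.comp (continuous_id.add continuous_const), C * (2 + 2 * a ^ 2), fun x => ?_⟩
  have h1 := hC (x + a)
  have h2 : 1 + x ^ 2 ≤ (2 + 2 * a ^ 2) * (1 + (x + a) ^ 2) := by
    nlinarith [sq_nonneg (x + 2 * a), mul_nonneg (sq_nonneg a) (sq_nonneg (x + a))]
  calc |f (x + a)| * (1 + x ^ 2) ≤ |f (x + a)| * ((2 + 2 * a ^ 2) * (1 + (x + a) ^ 2)) := by
        gcongr
    _ = (|f (x + a)| * (1 + (x + a) ^ 2)) * (2 + 2 * a ^ 2) := by ring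
    _ ≤ _ := by gcongr

lemma tendsto_inv_aux (C : ℝ) {l : Filter ℝ} (hl : Tendsto (fun x : ℝ => x ^ 2) l atTop) :
    Tendsto (fun x : ℝ => C * (1 + x ^ 2)⁻¹) l (𝓝 0) := by
  have h : Tendsto (fun x : ℝ => 1 + x ^ 2) l atTop := tendsto_atTop_add_const_left _ _ hl
  simpa using (tendsto_inv_atTop_zero.comp h).const_mul C

lemma tendsto_of_sq (hf : Dec f) {l : Filter ℝ} (hl : Tendsto (fun x : ℝ => x ^ 2) l atTop) :
    Tendsto f l (𝓝 0) := by
  obtain ⟨hc, C, hC⟩ := hf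
  exact squeeze_zero_norm (fun x => le_inv hC x) (tendsto_inv_aux C hl)

lemma sq_atTop : Tendsto (fun x : ℝ => x ^ 2) atTop atTop := tendsto_pow_atTop (by norm_num)

lemma sq_atBot : Tendsto (fun x : ℝ => x ^ 2) atBot atTop := by
  have := sq_atTop.comp tendsto_neg_atBot_atTop
  refine this.congr fun x => ?_
  simp

lemma tendsto_atTop (hf : Dec f) : Tendsto f atTop (𝓝 0) := hf.tendsto_of_sq sq_atTop

lemma tendsto_atBot (hf : Dec f) : Tendsto f atBot (𝓝 0) := hf.tendsto_of_sq sq_atBot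

lemma integral_deriv (hf : Dec f) (hg : Dec g) (h : ∀ x, HasDerivAt f (g x) x) :
    ∫ x, g x = 0 := by
  have := integral_of_hasDerivAt_of_tendsto h hg.integrable hf.tendsto_atBot hf.tendsto_atTop
  simpa using this

/-- Sobolev embedding. -/
lemma sup_bound (hf : Dec f) (hg : Dec g) (h : ∀ x, HasDerivAt f (g x) x) (x : ℝ) :
    f x ^ 2 ≤ ∫ y, (f y ^ 2 + g y ^ 2) := by
  have h1 : ∀ x, HasDerivAt (fun y => f y ^ 2) (2 * f x * g x) x := fun x => by
    simpa using (h x).fun_pow 2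
  have hd : Dec (fun y => 2 * f y * g y) := (hf.const_mul 2).mul hg
  have h2 := integral_Iic_of_hasDerivAt_of_tendsto' (a := x) (fun y _ => h1 y)
    hd.integrable.integrableOn hf.sq.tendsto_atBot
  have hi := (hf.sq.add hg.sq).integrable
  calc f x ^ 2 = ∫ y in Iic x, 2 * f y * g y := by rw [h2]; simp
    _ ≤ ∫ y in Iic x, (f y ^ 2 + g y ^ 2) := by
        refine setIntegral_mono hd.integrable.integrableOn hi.integrableOn fun y => ?_
        dsimp only
        nlinarith [sq_nonneg (f y - g y)]
    _ ≤ _ := setIntegral_le_integral hi (Eventually.of_forall fun y => by positivity)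

lemma cauchy_schwarz (hf : Dec f) (hg : Dec g) :
    (∫ x, f x * g x) ^ 2 ≤ (∫ x, f x ^ 2) * ∫ x, g x ^ 2 := by
  have key : ∀ t : ℝ, 0 ≤ (∫ x, g x ^ 2) * (t * t) + (2 * ∫ x, f x * g x) * t + ∫ x, f x ^ 2 := by
    intro t
    have : 0 ≤ ∫ x, (f x + t * g x) ^ 2 := integral_nonneg fun x => by positivity
    have e : ∫ x, (f x + t * g x) ^ 2 = ∫ x, (f x ^ 2 + ((2 * t) * (f x * g x) + (t * t) * g x ^ 2)) := by
      congr 1; ext x; ring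
    rw [e, integral_add hf.sq.integrable (((hf.mul hg).const_mul _).add (hg.sq.const_mul _)).integrable,
      integral_add ((hf.mul hg).const_mul _).integrable (hg.sq.const_mul _).integrable,
      integral_const_mul, integral_const_mul] at this
    linarith
  have := discrim_le_zero key
  unfold discrim at this
  nlinarith

end Dec

lemma dec_schwartz (f : SchwartzMap ℝ ℝ) : Dec f := by
  refine ⟨f.continuous, ?_⟩
  obtain ⟨C0, h0⟩ := f.decay 0 0
  obtain ⟨C2, h2⟩ := f.decay 2 0
  refine ⟨C0 + C2, fun x => ?_⟩
  have a := h0.2 x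
  have b := h2.2 x
  simp only [pow_zero, one_mul, norm_iteratedFDeriv_zero, Real.norm_eq_abs, sq_abs] at a b
  nlinarith

lemma dec_schwartz_iter (f : SchwartzMap ℝ ℝ) (n : ℕ) : Dec (iteratedDeriv n f) := by
  induction n generalizing f with
  | zero => simpa using dec_schwartz f
  | succ n ih =>
    rw [iteratedDeriv_succ']
    have := ih (SchwartzMap.derivCLM ℝ ℝ f)
    exact (funext fun x => (SchwartzMap.derivCLM_apply ℝ f x).symm :
      deriv (f : ℝ → ℝ) = SchwartzMap.derivCLM ℝ ℝ f) ▸ this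

open MeasureTheory
open Filter Topology Set

/-- First derivative of the soliton. -/
noncomputable def Q1 (x : ℝ) : ℝ := - Q x * (Real.sinh (x / 2) / Real.cosh (x / 2))

lemma Q_pos (x : ℝ) : 0 < Q x := by
  unfold Q
  have := Real.cosh_pos (x / 2)
  positivity

lemma Q_le (x : ℝ) : Q x ≤ 3 := by
  unfold Q
  have h := Real.one_le_cosh (x / 2)
  have : 1 / Real.cosh (x / 2) ≤ 1 := by rw [div_le_one (by positivity)]; exact h
  have h0 : 0 ≤ 1 / Real.cosh (x / 2) := by positivity
  nlinarith

lemma Q_deriv (x : ℝ) : HasDerivAt Q (Q1 x) x := by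
  have hc := Real.cosh_pos (x / 2)
  have h1 : HasDerivAt (fun x : ℝ => x / 2) (1 / 2) x := (hasDerivAt_id x).div_const 2
  have h2 := (Real.hasDerivAt_cosh (x / 2)).comp x h1
  have h3 := ((h2.fun_inv hc.ne').fun_pow 2).const_mul 3
  have e : Q = fun y => 3 * ((Real.cosh ∘ fun x : ℝ => x / 2) y)⁻¹ ^ 2 := by
    funext y; simp [Q]
  rw [e]
  refine h3.congr_deriv ?_
  simp only [Q1, Q, Function.comp, Nat.cast_ofNat, Nat.add_one_sub_one, pow_one]
  field_simp

lemma tanh_deriv (x : ℝ) : HasDerivAt (fun x => Real.sinh (x / 2) / Real.cosh (x / 2)) (Q x / 6) x := by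
  have hc := Real.cosh_pos (x / 2)
  have h1 : HasDerivAt (fun x : ℝ => x / 2) (1 / 2) x := (hasDerivAt_id x).div_const 2
  have h2 := (Real.hasDerivAt_cosh (x / 2)).comp x h1
  have h3 := (Real.hasDerivAt_sinh (x / 2)).comp x h1
  refine (h3.div h2 hc.ne').congr_deriv ?_
  simp only [Q, Function.comp]
  have := Real.cosh_sq (x / 2)
  field_simp
  rw [this]; ring

lemma Q_tanh (x : ℝ) : Q x = 3 * (1 - (Real.sinh (x / 2) / Real.cosh (x / 2)) ^ 2) := by
  have hc := Real.cosh_pos (x / 2)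
  have := Real.cosh_sq (x / 2)
  unfold Q
  field_simp
  rw [this]; ring

lemma Q1_deriv (x : ℝ) : HasDerivAt Q1 (Q x - Q x ^ 2 / 2) x := by
  have := (Q_deriv x).neg.mul (tanh_deriv x)
  refine this.congr_deriv ?_
  have h := Q_tanh x
  unfold Q1
  simp only [Pi.neg_apply]
  set T := Real.sinh (x / 2) / Real.cosh (x / 2)
  have hT : T ^ 2 = 1 - Q x / 3 := by linarith
  linear_combination Q x * hT

lemma abs_tanh_le (x : ℝ) : |Real.sinh (x / 2) / Real.cosh (x / 2)| ≤ 1 := by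
  have hc := Real.cosh_pos (x / 2)
  have := Real.cosh_sq (x / 2)
  rw [abs_div, abs_of_pos hc, div_le_one hc]
  exact abs_le_of_sq_le_sq (by linarith) hc.le

lemma Q1_abs (x : ℝ) : |Q1 x| ≤ Q x := by
  unfold Q1
  rw [abs_mul, abs_neg, abs_of_pos (Q_pos x)]
  have := abs_tanh_le x
  have := Q_pos x
  nlinarith

lemma Q_cont : Continuous Q := continuous_iff_continuousAt.2 fun x => (Q_deriv x).continuousAt

lemma Q1_cont : Continuous Q1 := continuous_iff_continuousAt.2 fun x => (Q1_deriv x).continuousAt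

lemma cosh_ge (y : ℝ) : 1 + y ^ 2 / 2 ≤ Real.cosh y := by
  have h1 : Real.cosh y = 1 + 2 * Real.sinh (y / 2) ^ 2 := by
    have := Real.cosh_two_mul (y / 2)
    rw [show 2 * (y / 2) = y by ring] at this
    rw [this, Real.cosh_sq]; ring
  have h2 : (y / 2) ^ 2 ≤ Real.sinh (y / 2) ^ 2 := by
    rw [sq_le_sq]
    rw [Real.abs_sinh]
    exact Real.self_le_sinh_iff.2 (abs_nonneg _)
  rw [h1]; nlinarith

lemma Q_decay (x : ℝ) : Q x * (1 + x ^ 2) * (1 + |x|) ≤ 96 := by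
  have h := cosh_ge (x / 2)
  have hc := Real.cosh_pos (x / 2)
  have h1 : 1 + x ^ 2 ≤ 8 * Real.cosh (x / 2) := by nlinarith [sq_nonneg x]
  have h2 : 1 + |x| ≤ 4 * Real.cosh (x / 2) := by
    have : |x| ^ 2 = x ^ 2 := sq_abs x
    nlinarith [sq_nonneg (|x| - 1)]
  have h3 : (1 + x ^ 2) * (1 + |x|) ≤ (8 * Real.cosh (x / 2)) * (4 * Real.cosh (x / 2)) :=
    mul_le_mul h1 h2 (by positivity) (by positivity)
  have h4 : Q x * Real.cosh (x / 2) ^ 2 = 3 := by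
    unfold Q; field_simp
  have := Q_pos x
  nlinarith

lemma Q_dec : Dec Q := by
  refine ⟨Q_cont, 96, fun x => le_trans ?_ (Q_decay x)⟩
  have := Q_pos x
  rw [abs_of_pos this]
  have h : 0 ≤ Q x * (1 + x ^ 2) := by positivity
  nlinarith [abs_nonneg x]

lemma xQ_dec : Dec (fun x => x * Q x) := by
  refine ⟨continuous_id.mul Q_cont, 96, fun x => le_trans ?_ (Q_decay x)⟩
  have := Q_pos x
  rw [abs_mul, abs_of_pos this]
  have h : 0 ≤ Q x * (1 + x ^ 2) := by positivity
  nlinarith [abs_nonneg x]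

lemma Q1_dec : Dec Q1 := Q_dec.of_le Q1_cont fun x => by
  rw [abs_of_pos (Q_pos x)]; exact Q1_abs x

lemma xQ1_dec : Dec (fun x => x * Q1 x) := xQ_dec.of_le (continuous_id.mul Q1_cont) fun x => by
  rw [abs_mul, abs_mul, abs_of_pos (Q_pos x)]
  exact mul_le_mul_of_nonneg_left (Q1_abs x) (abs_nonneg _)

/-- Scaling generator. -/
noncomputable def La (x : ℝ) : ℝ := Q x + x * Q1 x / 2
/-- Derivative of the scaling generator. -/
noncomputable def La1 (x : ℝ) : ℝ := 3 / 2 * Q1 x + x * (Q x - Q x ^ 2 / 2) / 2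
/-- Second derivative of the scaling generator. -/
noncomputable def La2 (x : ℝ) : ℝ := 2 * (Q x - Q x ^ 2 / 2) + x * (Q1 x - Q x * Q1 x) / 2

lemma Q2_deriv (x : ℝ) : HasDerivAt (fun x => Q x - Q x ^ 2 / 2) (Q1 x - Q x * Q1 x) x := by
  refine ((Q_deriv x).sub (((Q_deriv x).pow 2).div_const 2)).congr_deriv ?_
  simp; ring

lemma La_deriv (x : ℝ) : HasDerivAt La (La1 x) x := by
  refine ((Q_deriv x).add (((hasDerivAt_id x).mul (Q1_deriv x)).div_const 2)).congr_deriv ?_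
  simp [La1]; ring

lemma La1_deriv (x : ℝ) : HasDerivAt La1 (La2 x) x := by
  refine (((Q1_deriv x).const_mul (3/2)).add
    (((hasDerivAt_id x).mul (Q2_deriv x)).div_const 2)).congr_deriv ?_
  simp [La2]; ring

lemma La_dec : Dec La := Q_dec.add (xQ1_dec.div_const 2)

lemma Q2_dec : Dec (fun x => Q x - Q x ^ 2 / 2) := Q_dec.sub (Q_dec.sq.div_const 2)

lemma Q3_dec : Dec (fun x => Q1 x - Q x * Q1 x) := Q1_dec.sub (Q_dec.mul Q1_dec)

lemma La1_dec : Dec La1 := by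
  have h : Dec (fun x => x * (Q x - Q x ^ 2 / 2)) := by
    have := xQ_dec.sub ((xQ_dec.mul Q_dec).div_const 2)
    refine (funext fun x => ?_ : (fun x => x * (Q x - Q x ^ 2 / 2)) = _) ▸ this
    ring
  exact (Q1_dec.const_mul (3/2)).add (h.div_const 2)

lemma La2_dec : Dec La2 := by
  have h : Dec (fun x => x * (Q1 x - Q x * Q1 x)) := by
    have := xQ1_dec.sub (xQ1_dec.mul Q_dec)
    refine (funext fun x => ?_ : (fun x => x * (Q1 x - Q x * Q1 x)) = _) ▸ this
    ring
  exact (Q2_dec.const_mul 2).add (h.div_const 2)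

lemma La_eq (x : ℝ) : -La2 x + La x - Q x * La x = - Q x := by
  unfold La La2; ring

open MeasureTheory
open Filter Topology Set

/-- Logarithmic derivative of the third eigenfunction of the linearized operator. -/
noncomputable def GG (x : ℝ) : ℝ := -(3 / 2) * (Real.sinh (x / 2) / Real.cosh (x / 2)) +
  4 * Real.sinh (x / 2) * Real.cosh (x / 2) / (4 * Real.sinh (x / 2) ^ 2 - 1)

lemma half_deriv (x : ℝ) : HasDerivAt (fun x : ℝ => x / 2) (1 / 2) x := (hasDerivAt_id x).div_const 2

lemma sinh_half_deriv (x : ℝ) : HasDerivAt (fun x : ℝ => Real.sinh (x / 2)) (Real.cosh (x / 2) / 2) x := by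
  refine ((Real.hasDerivAt_sinh (x / 2)).comp x (half_deriv x)).congr_deriv ?_
  ring

lemma cosh_half_deriv (x : ℝ) : HasDerivAt (fun x : ℝ => Real.cosh (x / 2)) (Real.sinh (x / 2) / 2) x := by
  refine ((Real.hasDerivAt_cosh (x / 2)).comp x (half_deriv x)).congr_deriv ?_
  ring

lemma PP_deriv (x : ℝ) : HasDerivAt (fun x : ℝ => 4 * Real.sinh (x / 2) ^ 2 - 1)
    (4 * Real.sinh (x / 2) * Real.cosh (x / 2)) x := by
  refine ((((sinh_half_deriv x).fun_pow 2).const_mul 4).sub_const 1).congr_deriv ?_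
  simp; ring

lemma GG_deriv (x : ℝ) (hx : 4 * Real.sinh (x / 2) ^ 2 - 1 ≠ 0) :
    HasDerivAt GG (1 / 4 - Q x - GG x ^ 2) x := by
  have h1 := (tanh_deriv x).const_mul (-(3 / 2))
  have h2 := (((sinh_half_deriv x).const_mul 4).fun_mul (cosh_half_deriv x)).fun_div (PP_deriv x) hx
  refine (h1.add h2).congr_deriv ?_
  have hc := Real.cosh_pos (x / 2)
  have hq := Q_tanh x
  have hcc := Real.cosh_sq (x / 2)
  unfold GG
  rw [hq]
  set s := Real.sinh (x / 2)
  set c := Real.cosh (x / 2)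
  have hP : (4 * s ^ 2 - 1) ≠ 0 := hx
  obtain ⟨T, hT⟩ : ∃ T, T = s / c := ⟨_, rfl⟩
  obtain ⟨w, hw⟩ : ∃ w, w = (4 * s ^ 2 - 1)⁻¹ := ⟨_, rfl⟩
  have hT' : T * c = s := by rw [hT]; field_simp
  have hw' : w * (4 * s ^ 2 - 1) = 1 := by rw [hw]; exact inv_mul_cancel₀ hP
  have e : c ^ 2 = s ^ 2 + 1 := hcc
  have e1 : ((4 * (c / 2) * c + 4 * s * (s / 2)) * (4 * s ^ 2 - 1) - 4 * s * c * (4 * s * c)) /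
      (4 * s ^ 2 - 1) ^ 2 = (2 * c ^ 2 + 2 * s ^ 2) * w - 16 * s ^ 2 * c ^ 2 * w ^ 2 := by
    rw [hw]; field_simp
    ring
  have e2 : 4 * s * c / (4 * s ^ 2 - 1) = 4 * s * c * w := by rw [hw]; rfl
  rw [e1, e2, ← hT]
  linear_combination (-2) * hw' - 12 * s * w * hT' + 2 * w * e

/-- The positive zero. -/
noncomputable def x0 : ℝ := 2 * Real.arsinh (1 / 2)

lemma x0_pos : 0 < x0 := by
  unfold x0
  have := Real.arsinh_pos_iff.2 (show (0:ℝ) < 1 / 2 by norm_num)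
  linarith

lemma sinh_x0 : Real.sinh (x0 / 2) = 1 / 2 := by
  unfold x0
  rw [mul_div_cancel_left₀ _ (by norm_num : (2:ℝ) ≠ 0), Real.sinh_arsinh]

lemma PP_ne {x : ℝ} (h1 : x ≠ x0) (h2 : x ≠ -x0) : 4 * Real.sinh (x / 2) ^ 2 - 1 ≠ 0 := by
  intro h
  have : (Real.sinh (x / 2) - 1 / 2) * (Real.sinh (x / 2) + 1 / 2) = 0 := by linarith
  rcases mul_eq_zero.1 this with h | h
  · apply h1
    have : x / 2 = x0 / 2 := Real.sinh_injective (by rw [sinh_x0]; linarith)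
    linarith
  · apply h2
    have : x / 2 = (-x0) / 2 := Real.sinh_injective (by rw [neg_div, Real.sinh_neg, sinh_x0]; linarith)
    linarith

lemma rsq_cont {r r1 : ℝ → ℝ} (hr : ∀ x, HasDerivAt r (r1 x) x) {z : ℝ} (hz : r z = 0)
    (hP : 4 * Real.sinh (z / 2) ^ 2 - 1 = 0) :
    ContinuousAt (fun x => r x ^ 2 / (4 * Real.sinh (x / 2) ^ 2 - 1)) z := by
  rw [continuousAt_iff_punctured_nhds]
  have h1 := hasDerivAt_iff_tendsto_slope.1 (hr z)
  have h2 := hasDerivAt_iff_tendsto_slope.1 (PP_deriv z)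
  have h0 : Tendsto r (𝓝[≠] z) (𝓝 0) := by
    have := (hr z).continuousAt.tendsto
    rw [hz] at this
    exact this.mono_left nhdsWithin_le_nhds
  have hne : 4 * Real.sinh (z / 2) * Real.cosh (z / 2) ≠ 0 := by
    have hs : Real.sinh (z / 2) ≠ 0 := by
      intro h; rw [h] at hP; norm_num at hP
    have := Real.cosh_pos (z / 2)
    positivity
  have h3 := h0.mul (h1.div h2 hne)
  rw [hz]
  simp only [zero_mul] at h3
  simp only [ne_eq, OfNat.ofNat_ne_zero, not_false_eq_true, zero_pow, zero_div]
  refine h3.congr' ?_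
  filter_upwards [self_mem_nhdsWithin] with x hx
  have hx' : x - z ≠ 0 := sub_ne_zero.2 hx
  simp only [Pi.div_apply, slope_def_field, hz, hP, sub_zero]
  rw [div_div_div_cancel_right₀ hx']
  ring

lemma H_cont {r r1 : ℝ → ℝ} (hr : ∀ x, HasDerivAt r (r1 x) x) (h1 : r x0 = 0) (h2 : r (-x0) = 0) :
    Continuous (fun x => r x ^ 2 * GG x) := by
  have key : Continuous (fun x => r x ^ 2 / (4 * Real.sinh (x / 2) ^ 2 - 1)) := by
    rw [continuous_iff_continuousAt]
    intro z
    by_cases hP : 4 * Real.sinh (z / 2) ^ 2 - 1 = 0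
    · refine rsq_cont hr ?_ hP
      by_contra hz
      exact PP_ne (fun h => hz (by rw [h]; exact h1)) (fun h => hz (by rw [h]; exact h2)) hP
    · exact ((hr z).continuousAt.pow 2).div (PP_deriv z).continuousAt hP
  have hrc : Continuous r := continuous_iff_continuousAt.2 fun x => (hr x).continuousAt
  have hT : Continuous (fun x => Real.sinh (x / 2) / Real.cosh (x / 2)) :=
    continuous_iff_continuousAt.2 fun x => (tanh_deriv x).continuousAt
  have hs : Continuous (fun x : ℝ => Real.sinh (x / 2)) :=
    continuous_iff_continuousAt.2 fun x => (sinh_half_deriv x).continuousAt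
  have hc : Continuous (fun x : ℝ => Real.cosh (x / 2)) :=
    continuous_iff_continuousAt.2 fun x => (cosh_half_deriv x).continuousAt
  have := ((hrc.pow 2).mul (hT.const_mul (-(3/2)))).add (((hs.const_mul 4).mul hc).mul key)
  refine this.congr fun x => ?_
  simp only [GG, Pi.add_apply, Pi.mul_apply, Pi.pow_apply]
  ring

lemma GG_bdd {x : ℝ} (hx : 2 ≤ |x|) : |GG x| ≤ 4 := by
  have h1 := abs_tanh_le x
  have hs : 1 ≤ Real.sinh (x / 2) ^ 2 := by
    have : 1 ≤ |Real.sinh (x / 2)| := by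
      rw [Real.abs_sinh]
      have h2 : 1 ≤ |x / 2| := by rw [abs_div, abs_two]; linarith
      exact h2.trans (Real.self_le_sinh_iff.2 (abs_nonneg _))
    rw [← sq_abs]; nlinarith
  have hcc := Real.cosh_sq (x / 2)
  have hP : 0 < 4 * Real.sinh (x / 2) ^ 2 - 1 := by linarith
  have h2 : |4 * Real.sinh (x / 2) * Real.cosh (x / 2) / (4 * Real.sinh (x / 2) ^ 2 - 1)| ≤ 5 / 2 := by
    rw [abs_div, abs_of_pos hP, div_le_iff₀ hP]
    refine abs_le_of_sq_le_sq ?_ (by linarith)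
    rw [mul_pow, hcc]
    nlinarith
  unfold GG
  refine (abs_add_le _ _).trans ?_
  rw [abs_mul, abs_of_neg (by norm_num : (-(3/2):ℝ) < 0)]
  linarith

lemma sturm {r r1 : ℝ → ℝ} (hr : ∀ x, HasDerivAt r (r1 x) x) (hd : Dec r) (hd1 : Dec r1)
    (h1 : r x0 = 0) (h2 : r (-x0) = 0) :
    0 ≤ ∫ x, (r1 x ^ 2 + (1 / 4 * r x ^ 2 - Q x * r x ^ 2)) := by
  set φ : ℝ → ℝ := fun x => r1 x ^ 2 + (1 / 4 * r x ^ 2 - Q x * r x ^ 2) with hφ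
  have hφd : Dec φ := hd1.sq.add ((hd.sq.const_mul _).sub (Q_dec.mul hd.sq))
  set Φ : ℝ → ℝ := fun x => (∫ y in (0:ℝ)..x, φ y) - r x ^ 2 * GG x with hΦ
  have hI : ∀ x, HasDerivAt (fun x => ∫ y in (0:ℝ)..x, φ y) (φ x) x := fun x =>
    intervalIntegral.integral_hasDerivAt_right (hφd.cont.intervalIntegrable _ _)
      (hφd.cont.stronglyMeasurableAtFilter _ _) hφd.cont.continuousAt
  have hIc : Continuous (fun x => ∫ y in (0:ℝ)..x, φ y) :=
    continuous_iff_continuousAt.2 fun x => (hI x).continuousAt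
  have hc : Continuous Φ := hIc.sub (H_cont hr h1 h2)
  have hder : ∀ x, x ≠ x0 → x ≠ -x0 → HasDerivAt Φ ((r1 x - GG x * r x) ^ 2) x := by
    intro x hx hx'
    refine ((hI x).sub (((hr x).fun_pow 2).fun_mul (GG_deriv x (PP_ne hx hx')))).congr_deriv ?_
    simp only [hφ]
    push_cast
    ring
  have mono : ∀ a b : ℝ, a ≤ b → (∀ x ∈ Ioo a b, x ≠ x0 ∧ x ≠ -x0) → Φ a ≤ Φ b := by
    intro a b hab hx
    have : MonotoneOn Φ (Icc a b) := by
      refine monotoneOn_of_deriv_nonneg (convex_Icc a b) hc.continuousOn ?_ ?_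
      · rw [interior_Icc]
        exact fun x h => (hder x (hx x h).1 (hx x h).2).differentiableAt.differentiableWithinAt
      · rw [interior_Icc]
        intro x h
        rw [(hder x (hx x h).1 (hx x h).2).deriv]
        positivity
    exact this ⟨le_rfl, hab⟩ ⟨hab, le_rfl⟩ hab
  have hx0 := x0_pos
  have hall : ∀ R, x0 ≤ R → Φ (-R) ≤ Φ R := by
    intro R hR
    have a := mono (-R) (-x0) (by linarith) fun x h => ⟨by linarith [h.2], by linarith [h.2]⟩
    have b := mono (-x0) x0 (by linarith) fun x h => ⟨h.2.ne, h.1.ne'⟩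
    have c := mono x0 R hR fun x h => ⟨h.1.ne', by linarith [h.1]⟩
    linarith
  have hlim := intervalIntegral_tendsto_integral hφd.integrable tendsto_neg_atTop_atBot tendsto_id
  have hr2 : Tendsto (fun R : ℝ => 4 * r R ^ 2 + 4 * r (-R) ^ 2) atTop (𝓝 0) := by
    have a := (hd.sq.tendsto_atTop).const_mul 4
    have b := ((hd.sq.tendsto_atBot).comp tendsto_neg_atTop_atBot).const_mul 4
    simpa using a.add b
  have hlim2 := hlim.add hr2
  rw [add_zero] at hlim2
  refine ge_of_tendsto hlim2 ?_
  filter_upwards [eventually_ge_atTop x0, eventually_ge_atTop 2] with R hR hR2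
  have a := hall R hR
  have e : (∫ y in (-R)..R, φ y) = (∫ y in (0:ℝ)..R, φ y) - ∫ y in (0:ℝ)..(-R), φ y :=
    (intervalIntegral.integral_interval_sub_left (hφd.cont.intervalIntegrable _ _)
      (hφd.cont.intervalIntegrable _ _)).symm
  have g1 := abs_le.1 (GG_bdd (x := R) (by rw [abs_of_nonneg] <;> linarith))
  have g2 := abs_le.1 (GG_bdd (x := -R) (by rw [abs_neg, abs_of_nonneg] <;> linarith))
  simp only [hΦ] at a
  simp only [id]
  rw [e]
  nlinarith [sq_nonneg (r R), sq_nonneg (r (-R))]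

open MeasureTheory
open Filter Topology Set

lemma kappa : ∫ x, Q x * La x = 3 / 4 * ∫ x, Q x ^ 2 := by
  have hd : ∀ x, HasDerivAt (fun x => x * Q x * Q x) (Q x ^ 2 + 2 * (x * Q1 x) * Q x) x := fun x => by
    refine (((hasDerivAt_id x).fun_mul (Q_deriv x)).fun_mul (Q_deriv x)).congr_deriv ?_
    simp only [id]; ring
  have h := Dec.integral_deriv (xQ_dec.mul Q_dec)
    (Q_dec.sq.add ((xQ1_dec.const_mul 2).mul Q_dec)) hd
  have e : (fun x => Q x * La x) = fun x => 3 / 4 * Q x ^ 2 + 1 / 4 * (Q x ^ 2 + 2 * (x * Q1 x) * Q x) := by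
    funext x; unfold La; ring
  rw [e, integral_add (Q_dec.sq.const_mul _).integrable
    ((Q_dec.sq.add ((xQ1_dec.const_mul 2).mul Q_dec)).const_mul _).integrable,
    integral_const_mul, integral_const_mul, h]
  ring

lemma Qsq_pos : 0 < ∫ x, Q x ^ 2 := by
  have : 0 ≤ ∫ x, Q x ^ 2 := integral_nonneg fun x => by positivity
  refine lt_of_le_of_ne this fun h => ?_
  have h2 := (integral_eq_zero_iff_of_nonneg (fun x => by positivity) Q_dec.sq.integrable).1 h.symm
  have h3 : (fun x => Q x ^ 2) = fun _ => (0 : ℝ) :=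
    ((Q_cont.pow 2).ae_eq_iff_eq (μ := volume) (continuous_const : Continuous fun _ : ℝ => (0 : ℝ))).1 h2
  have := congrFun h3 0
  have hq := Q_pos 0
  simp at this
  linarith

lemma Q1sq_pos : 0 < ∫ x, Q1 x ^ 2 := by
  have : 0 ≤ ∫ x, Q1 x ^ 2 := integral_nonneg fun x => by positivity
  refine lt_of_le_of_ne this fun h => ?_
  have h2 := (integral_eq_zero_iff_of_nonneg (fun x => by positivity) Q1_dec.sq.integrable).1 h.symm
  have h3 : (fun x => Q1 x ^ 2) = fun _ => (0 : ℝ) :=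
    ((Q1_cont.pow 2).ae_eq_iff_eq (μ := volume) (continuous_const : Continuous fun _ : ℝ => (0 : ℝ))).1 h2
  have := congrFun h3 1
  have hq := Q_pos 1
  have hs : 0 < Real.sinh (1 / 2) := by rw [Real.sinh_pos_iff]; norm_num
  have hc := Real.cosh_pos (1 / 2)
  simp only [Pi.pow_apply, ne_eq, OfNat.ofNat_ne_zero, not_false_eq_true, pow_eq_zero_iff, Q1] at this
  have h4 : 0 < Q 1 * (Real.sinh (1 / 2) / Real.cosh (1 / 2)) := by positivity
  linarith

lemma Q_even (x : ℝ) : Q (-x) = Q x := by unfold Q; rw [neg_div, Real.cosh_neg]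

lemma Q1_odd (x : ℝ) : Q1 (-x) = - Q1 x := by
  unfold Q1; rw [neg_div, Real.cosh_neg, Real.sinh_neg, Q_even]; ring

lemma La_even (x : ℝ) : La (-x) = La x := by unfold La; rw [Q_even, Q1_odd]; ring

lemma Q1_x0 : Q1 x0 ≠ 0 := by
  unfold Q1
  rw [sinh_x0]
  have := Q_pos x0
  have hc := Real.cosh_pos (x0 / 2)
  have : 0 < Q x0 * (1 / 2 / Real.cosh (x0 / 2)) := by positivity
  linarith

lemma La_x0 : La x0 ≠ 0 := by
  have hq := Q_pos x0
  have hc := Real.one_le_cosh (x0 / 2)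
  have h0 := x0_pos
  have hx : x0 / 2 ≤ 1 / 2 := by
    rw [← sinh_x0]; exact Real.self_le_sinh_iff.2 (by linarith)
  have hT : 1 / 2 / Real.cosh (x0 / 2) ≤ 1 / 2 := div_le_self (by norm_num) hc
  have hT0 : 0 ≤ 1 / 2 / Real.cosh (x0 / 2) := by positivity
  have : La x0 = Q x0 * (1 - x0 / 2 * (1 / 2 / Real.cosh (x0 / 2))) := by
    unfold La Q1; rw [sinh_x0]; ring
  rw [this]
  refine mul_ne_zero hq.ne' ?_
  nlinarith

lemma decomp {v v1 : ℝ → ℝ} (hv : ∀ x, HasDerivAt v (v1 x) x) (hd : Dec v) (hd1 : Dec v1) :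
    ∃ α β : ℝ, ∃ r : ℝ → ℝ, Dec r ∧ (∀ x, v x = α * La x + β * Q1 x + r x) ∧
      (∫ x, (v1 x ^ 2 + (v x ^ 2 - Q x * v x ^ 2))) ≥
        3 / 4 * (∫ x, r x ^ 2) - 2 * α * (∫ x, Q x * v x) + α ^ 2 * ∫ x, Q x * La x := by
  have hL := La_x0
  have hQ := Q1_x0
  set α := (v x0 + v (-x0)) / (2 * La x0) with hα
  set β := (v x0 - v (-x0)) / (2 * Q1 x0) with hβ
  have e1 : α * La x0 = (v x0 + v (-x0)) / 2 := by rw [hα]; field_simp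
  have e2 : β * Q1 x0 = (v x0 - v (-x0)) / 2 := by rw [hβ]; field_simp
  set r : ℝ → ℝ := fun x => v x - (α * La x + β * Q1 x) with hr
  set r1 : ℝ → ℝ := fun x => v1 x - (α * La1 x + β * (Q x - Q x ^ 2 / 2)) with hr1
  have hrd : Dec r := hd.sub ((La_dec.const_mul α).add (Q1_dec.const_mul β))
  have hr1d : Dec r1 := hd1.sub ((La1_dec.const_mul α).add (Q2_dec.const_mul β))
  have hder : ∀ x, HasDerivAt r (r1 x) x := fun x =>
    (hv x).sub (((La_deriv x).const_mul α).add ((Q1_deriv x).const_mul β))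
  refine ⟨α, β, r, hrd, fun x => by simp only [hr]; ring, ?_⟩
  have hst := sturm hder hrd hr1d (by simp only [hr]; linarith)
    (by simp only [hr]; rw [La_even, Q1_odd]; linarith)
  -- the exact derivative
  set X : ℝ → ℝ := fun x => (-2 * α) * (La1 x * v x) + ((-2 * β) * ((Q x - Q x ^ 2 / 2) * v x) +
    (α ^ 2 * (La1 x * La x) + ((2 * α * β) * ((Q x - Q x ^ 2 / 2) * La x) +
      β ^ 2 * ((Q x - Q x ^ 2 / 2) * Q1 x)))) with hX
  set X1 : ℝ → ℝ := fun x => (-2 * α) * (La2 x * v x + La1 x * v1 x) +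
    ((-2 * β) * ((Q1 x - Q x * Q1 x) * v x + (Q x - Q x ^ 2 / 2) * v1 x) +
    (α ^ 2 * (La2 x * La x + La1 x * La1 x) +
    ((2 * α * β) * ((Q1 x - Q x * Q1 x) * La x + (Q x - Q x ^ 2 / 2) * La1 x) +
      β ^ 2 * ((Q1 x - Q x * Q1 x) * Q1 x + (Q x - Q x ^ 2 / 2) * (Q x - Q x ^ 2 / 2))))) with hX1
  have hXd : Dec X :=
    ((La1_dec.mul hd).const_mul _).add (((Q2_dec.mul hd).const_mul _).add
      (((La1_dec.mul La_dec).const_mul _).add (((Q2_dec.mul La_dec).const_mul _).add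
        ((Q2_dec.mul Q1_dec).const_mul _))))
  have hX1d : Dec X1 :=
    (((La2_dec.mul hd).add (La1_dec.mul hd1)).const_mul _).add
      ((((Q3_dec.mul hd).add (Q2_dec.mul hd1)).const_mul _).add
      ((((La2_dec.mul La_dec).add (La1_dec.mul La1_dec)).const_mul _).add
        ((((Q3_dec.mul La_dec).add (Q2_dec.mul La1_dec)).const_mul _).add
        (((Q3_dec.mul Q1_dec).add (Q2_dec.mul Q2_dec)).const_mul _))))
  have hXX : ∀ x, HasDerivAt X (X1 x) x := fun x =>
    (((La1_deriv x).fun_mul (hv x)).const_mul _).add ((((Q2_deriv x).fun_mul (hv x)).const_mul _).add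
      ((((La1_deriv x).fun_mul (La_deriv x)).const_mul _).add
      ((((Q2_deriv x).fun_mul (La_deriv x)).const_mul _).add
        (((Q2_deriv x).fun_mul (Q1_deriv x)).const_mul _))))
  have hI := Dec.integral_deriv hXd hX1d hXX
  have hB : Dec (fun x => v1 x ^ 2 + (v x ^ 2 - Q x * v x ^ 2)) :=
    hd1.sq.add (hd.sq.sub (Q_dec.mul hd.sq))
  have e : (fun x => r1 x ^ 2 + (1 / 4 * r x ^ 2 - Q x * r x ^ 2)) = fun x =>
      (v1 x ^ 2 + (v x ^ 2 - Q x * v x ^ 2)) + ((-3 / 4) * r x ^ 2 + ((2 * α) * (Q x * v x) +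
        ((-α ^ 2) * (Q x * La x) + X1 x))) := by
    funext x
    have hla := La_eq x
    have hla2 : La2 x = La x - Q x * La x + Q x := by linarith
    simp only [hr, hr1, hX1, hla2]
    ring
  rw [e, integral_add hB.integrable ((hrd.sq.const_mul _).add (((Q_dec.mul hd).const_mul _).add
      (((Q_dec.mul La_dec).const_mul _).add hX1d))).integrable,
    integral_add (hrd.sq.const_mul _).integrable (((Q_dec.mul hd).const_mul _).add
      (((Q_dec.mul La_dec).const_mul _).add hX1d)).integrable,
    integral_add ((Q_dec.mul hd).const_mul _).integrable
      (((Q_dec.mul La_dec).const_mul _).add hX1d).integrable,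
    integral_add ((Q_dec.mul La_dec).const_mul _).integrable hX1d.integrable, hI,
    integral_const_mul, integral_const_mul, integral_const_mul] at hst
  linarith

lemma coercive : ∃ c > 0, ∃ c2 ≥ 0, ∀ v v1 : ℝ → ℝ, (∀ x, HasDerivAt v (v1 x) x) → Dec v → Dec v1 →
    (∫ x, v x * Q1 x) = 0 →
    c * (∫ x, v x ^ 2) ≤ (∫ x, (v1 x ^ 2 + (v x ^ 2 - Q x * v x ^ 2))) + c2 * (∫ x, Q x * v x) ^ 2 := by
  have hκ : 0 < ∫ x, Q x * La x := by rw [kappa]; linarith [Qsq_pos]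
  set κ := ∫ x, Q x * La x with hκd
  have hq := Q1sq_pos
  set q := ∫ x, Q1 x ^ 2 with hqd
  have hA : 0 ≤ ∫ x, La x ^ 2 := integral_nonneg fun x => by positivity
  set A := ∫ x, La x ^ 2 with hAd
  -- n ≤ 3 (α² A + β² q + ρ), β² q ≤ 2 (α² A + ρ)
  refine ⟨min (κ / 2 / (9 * (A + 1))) (1 / 12), lt_min (by positivity) (by norm_num), 2 / κ, by positivity, ?_⟩
  intro v v1 hv hd hd1 h0
  obtain ⟨α, β, r, hrd, hvr, hB⟩ := decomp hv hd hd1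
  have hρ : 0 ≤ ∫ x, r x ^ 2 := integral_nonneg fun x => by positivity
  set ρ := ∫ x, r x ^ 2 with hρd
  set m := ∫ x, Q x * v x with hm
  set B := ∫ x, (v1 x ^ 2 + (v x ^ 2 - Q x * v x ^ 2)) with hBd
  have h1 : (∫ x, (α * La x + r x) * Q1 x) = - (β * q) := by
    have e : (fun x => (α * La x + r x) * Q1 x) = fun x => v x * Q1 x - β * Q1 x ^ 2 := by
      funext x; rw [hvr x]; ring
    rw [e, integral_sub (hd.mul Q1_dec).integrable (Q1_dec.sq.const_mul _).integrable, h0,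
      integral_const_mul]
    ring
  have hw : Dec (fun x => α * La x + r x) := (La_dec.const_mul α).add hrd
  have h2 := Dec.cauchy_schwarz hw Q1_dec
  have h3 : (∫ x, (α * La x + r x) ^ 2) ≤ 2 * α ^ 2 * A + 2 * ρ := by
    rw [hAd, hρd, ← integral_const_mul, ← integral_const_mul,
      ← integral_add (La_dec.sq.const_mul _).integrable (hrd.sq.const_mul _).integrable]
    refine integral_mono hw.sq.integrable ((La_dec.sq.const_mul _).add (hrd.sq.const_mul _)).integrable
      fun x => ?_
    dsimp only
    nlinarith [sq_nonneg (α * La x - r x)]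
  have hβ : β ^ 2 * q ≤ 2 * α ^ 2 * A + 2 * ρ := by
    rw [h1] at h2
    have : q * (β ^ 2 * q) ≤ q * (2 * α ^ 2 * A + 2 * ρ) := by nlinarith
    exact le_of_mul_le_mul_left this hq
  have hn : (∫ x, v x ^ 2) ≤ 3 * α ^ 2 * A + (3 * β ^ 2 * q + 3 * ρ) := by
    rw [hAd, hρd, hqd, ← integral_const_mul, ← integral_const_mul, ← integral_const_mul,
      ← integral_add (Q1_dec.sq.const_mul _).integrable (hrd.sq.const_mul _).integrable,
      ← integral_add (La_dec.sq.const_mul _).integrable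
        ((Q1_dec.sq.const_mul _).add (hrd.sq.const_mul _)).integrable]
    refine integral_mono hd.sq.integrable ((La_dec.sq.const_mul _).add
      ((Q1_dec.sq.const_mul _).add (hrd.sq.const_mul _))).integrable fun x => ?_
    dsimp only
    rw [hvr x]
    nlinarith [sq_nonneg (α * La x - β * Q1 x), sq_nonneg (α * La x - r x),
      sq_nonneg (β * Q1 x - r x)]
  have hn2 : (∫ x, v x ^ 2) ≤ 9 * α ^ 2 * (A + 1) + 9 * ρ := by nlinarith [sq_nonneg α]
  have hn0 : 0 ≤ ∫ x, v x ^ 2 := integral_nonneg fun x => by positivity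
  have hcm : 2 * α * m ≤ κ / 2 * α ^ 2 + 2 / κ * m ^ 2 := by
    have : 0 ≤ (κ * α - 2 * m) ^ 2 / (2 * κ) := by positivity
    have e : (κ * α - 2 * m) ^ 2 / (2 * κ) = κ / 2 * α ^ 2 + 2 / κ * m ^ 2 - 2 * α * m := by
      field_simp; ring
    linarith
  have hfin : min (κ / 2 / (9 * (A + 1))) (1 / 12) * (9 * α ^ 2 * (A + 1) + 9 * ρ) ≤
      κ / 2 * α ^ 2 + 3 / 4 * ρ := by
    have a1 : min (κ / 2 / (9 * (A + 1))) (1 / 12) * (9 * α ^ 2 * (A + 1)) ≤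
        κ / 2 / (9 * (A + 1)) * (9 * α ^ 2 * (A + 1)) :=
      mul_le_mul_of_nonneg_right (min_le_left _ _) (by positivity)
    have a2 : min (κ / 2 / (9 * (A + 1))) (1 / 12) * (9 * ρ) ≤ 1 / 12 * (9 * ρ) :=
      mul_le_mul_of_nonneg_right (min_le_right _ _) (by positivity)
    have a3 : κ / 2 / (9 * (A + 1)) * (9 * α ^ 2 * (A + 1)) = κ / 2 * α ^ 2 := by field_simp
    rw [mul_add]; linarith
  have hmul : min (κ / 2 / (9 * (A + 1))) (1 / 12) * (∫ x, v x ^ 2) ≤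
      min (κ / 2 / (9 * (A + 1))) (1 / 12) * (9 * α ^ 2 * (A + 1) + 9 * ρ) :=
    mul_le_mul_of_nonneg_left hn2 (le_min (by positivity) (by norm_num))
  linarith

lemma cube_bound {v v1 : ℝ → ℝ} (hv : ∀ x, HasDerivAt v (v1 x) x) (hd : Dec v) (hd1 : Dec v1) :
    |∫ x, v x ^ 3| ≤ Real.sqrt ((∫ x, v x ^ 2) + ∫ x, v1 x ^ 2) * ∫ x, v x ^ 2 := by
  have hs : ∀ x, |v x| ≤ Real.sqrt ((∫ x, v x ^ 2) + ∫ x, v1 x ^ 2) := fun x => by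
    have := Dec.sup_bound hd hd1 hv x
    rw [integral_add hd.sq.integrable hd1.sq.integrable] at this
    exact Real.abs_le_sqrt this
  rw [← integral_const_mul]
  refine (abs_integral_le_integral_abs).trans
    (integral_mono hd.cube.abs.integrable (hd.sq.const_mul _).integrable fun x => ?_)
  dsimp only
  rw [abs_pow, pow_succ', sq_abs]
  exact mul_le_mul_of_nonneg_right (hs x) (sq_nonneg _)

lemma Qint_bound {v : ℝ → ℝ} (hd : Dec v) : (∫ x, Q x * v x ^ 2) ≤ 3 * ∫ x, v x ^ 2 := by
  rw [← integral_const_mul]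
  exact integral_mono (Q_dec.mul hd.sq).integrable (hd.sq.const_mul _).integrable fun x =>
    mul_le_mul_of_nonneg_right (Q_le x) (sq_nonneg _)

set_option maxHeartbeats 1000000 in
theorem static_main : ∃ r0 > 0, ∃ d0 > 0, ∃ C > 0, ∀ v v1 : ℝ → ℝ, (∀ x, HasDerivAt v (v1 x) x) →
    Dec v → Dec v1 → (∫ x, v x * Q1 x) = 0 → ∀ D : ℝ, (∫ x, v x ^ 2) ≤ r0 → D ≤ d0 →
    |2 * (∫ x, Q x * v x) + ∫ x, v x ^ 2| ≤ D →
    |(∫ x, (v1 x ^ 2 + (v x ^ 2 - Q x * v x ^ 2))) - 1 / 3 * ∫ x, v x ^ 3| ≤ D →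
    (∫ x, v x ^ 2) + (∫ x, v1 x ^ 2) ≤ C * D := by
  obtain ⟨c, hc, c2, hc2, hco⟩ := coercive
  refine ⟨min 1 (min (c ^ 2 / 10) (c / (2 * (c2 + 1)))), by positivity,
    min 1 (c ^ 2 / 10), by positivity, 1 + 8 / c * (1 + c2 / 2), by positivity, ?_⟩
  intro v v1 hv hd hd1 h0 D hr hD hM hS
  have hco := hco v v1 hv hd hd1 h0
  have hcu := cube_bound hv hd hd1
  have hQi := Qint_bound hd
  have hn : 0 ≤ ∫ x, v x ^ 2 := integral_nonneg fun x => by positivity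
  have hK : 0 ≤ ∫ x, v1 x ^ 2 := integral_nonneg fun x => by positivity
  have hB : (∫ x, (v1 x ^ 2 + (v x ^ 2 - Q x * v x ^ 2))) =
      (∫ x, v1 x ^ 2) + ((∫ x, v x ^ 2) - ∫ x, Q x * v x ^ 2) := by
    rw [integral_add hd1.sq.integrable (hd.sq.sub (Q_dec.mul hd.sq)).integrable,
      integral_sub hd.sq.integrable (Q_dec.mul hd.sq).integrable]
  rw [hB] at hS hco
  generalize (∫ x, v x ^ 2) = n at *
  generalize (∫ x, v1 x ^ 2) = K at *
  generalize (∫ x, Q x * v x) = m at *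
  generalize (∫ x, Q x * v x ^ 2) = q at *
  generalize (∫ x, v x ^ 3) = w at *
  have hD0 : 0 ≤ D := (abs_nonneg _).trans hM
  have hn1 : n ≤ 1 := hr.trans (min_le_left _ _)
  have hn2 : n ≤ c ^ 2 / 10 := hr.trans ((min_le_right _ _).trans (min_le_left _ _))
  have hn3 : n ≤ c / (2 * (c2 + 1)) := hr.trans ((min_le_right _ _).trans (min_le_right _ _))
  have hD1 : D ≤ 1 := hD.trans (min_le_left _ _)
  have hD2 : D ≤ c ^ 2 / 10 := hD.trans (min_le_right _ _)
  obtain ⟨s, hs⟩ : ∃ s, s = Real.sqrt (n + K) := ⟨_, rfl⟩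
  have hs0 : 0 ≤ s := hs ▸ Real.sqrt_nonneg _
  have hs2 : s ^ 2 = n + K := by rw [hs]; exact Real.sq_sqrt (by linarith)
  rw [← hs] at hcu
  have hS' := abs_le.1 hS
  have hcu' := abs_le.1 hcu
  have hM' := abs_le.1 hM
  have hK1 : K ≤ D + s * n / 3 + 2 * n := by linarith
  have hs3 : s ≤ 3 := by
    by_contra hh
    push Not at hh
    have : s * n ≤ s := by nlinarith
    nlinarith
  have hK2 : K ≤ D + 3 * n := by nlinarith
  have hs4 : s ^ 2 ≤ D + 4 * n := by linarith
  have hs5 : s ≤ 3 / 4 * c := by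
    refine le_of_sq_le_sq ?_ (by positivity)
    nlinarith
  have hm : m ^ 2 ≤ (D ^ 2 + n ^ 2) / 2 := by
    have : (2 * m) ^ 2 ≤ (D + n) ^ 2 := by
      rw [sq_le_sq, abs_of_nonneg (by linarith : 0 ≤ D + n)]
      refine abs_le.2 ⟨by linarith, by linarith⟩
    nlinarith [sq_nonneg (D - n)]
  have hm2 : c2 * m ^ 2 ≤ c2 * ((D ^ 2 + n ^ 2) / 2) := mul_le_mul_of_nonneg_left hm hc2
  have hc3 : c2 * n ^ 2 / 2 ≤ c / 4 * n := by
    rw [le_div_iff₀ (by positivity)] at hn3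
    have h6 : c2 * n ≤ c / 2 := by linarith
    have h7 := mul_le_mul_of_nonneg_right h6 hn
    calc c2 * n ^ 2 / 2 = c2 * n * n / 2 := by ring
      _ ≤ c / 2 * n / 2 := by linarith
      _ = c / 4 * n := by ring
  have hc4 : c2 * D ^ 2 / 2 ≤ c2 / 2 * D := by
    have h6 : D ^ 2 ≤ D := by rw [pow_two]; exact mul_le_of_le_one_left hD0 hD1
    have h7 := mul_le_mul_of_nonneg_left h6 hc2
    linarith
  have hmain : c * n ≤ D * (1 + c2 / 2) + c / 2 * n := by
    have h6 := mul_le_mul_of_nonneg_right hs5 hn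
    linarith
  have hn4 : n ≤ 2 / c * (1 + c2 / 2) * D := by
    have : n = 2 / c * (c / 2 * n) := by field_simp
    rw [this]
    have h5 : 0 ≤ 2 / c := by positivity
    calc 2 / c * (c / 2 * n) ≤ 2 / c * ((1 + c2 / 2) * D) := by
          refine mul_le_mul_of_nonneg_left ?_ h5
          linarith
      _ = _ := by ring
  have : (1 + 8 / c * (1 + c2 / 2)) * D = D + 4 * (2 / c * (1 + c2 / 2) * D) := by ring
  rw [this]
  linarith

open MeasureTheory
open Filter Topology Set

/-- Leibniz rule on a bounded interval. -/
lemma leibniz {ρ ρt : ℝ → ℝ → ℝ} (hρ : Continuous (Function.uncurry ρ))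
    (hρt : Continuous (Function.uncurry ρt))
    (ht : ∀ t x, HasDerivAt (fun t => ρ t x) (ρt t x) t) (a b t0 : ℝ) :
    HasDerivAt (fun t => ∫ x in a..b, ρ t x) (∫ x in a..b, ρt t0 x) t0 := by
  have hK : IsCompact (Metric.closedBall t0 1 ×ˢ uIcc a b) :=
    (isCompact_closedBall t0 1).prod isCompact_uIcc
  obtain ⟨C, hC⟩ := hK.exists_bound_of_continuousOn hρt.continuousOn
  have hs : ∀ t, Continuous (ρ t) := fun t => hρ.comp (continuous_const.prodMk continuous_id)
  have hst : ∀ t, Continuous (ρt t) := fun t => hρt.comp (continuous_const.prodMk continuous_id)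
  refine (intervalIntegral.hasDerivAt_integral_of_dominated_loc_of_deriv_le
    (F := ρ) (F' := ρt) (bound := fun _ => C) (Metric.ball_mem_nhds t0 one_pos)
    ?_ ?_ ?_ ?_ ?_ ?_).2
  · exact Eventually.of_forall fun t => (hs t).aestronglyMeasurable
  · exact (hs t0).intervalIntegrable _ _
  · exact (hst t0).aestronglyMeasurable
  · refine Eventually.of_forall fun x hx t htt => ?_
    exact hC (t, x) ⟨Metric.ball_subset_closedBall htt, uIoc_subset_uIcc hx⟩
  · exact intervalIntegrable_const
  · exact Eventually.of_forall fun x _ t _ => ht t x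

lemma cutoff_int {j1 j1x j2 j2x j2xx : ℝ → ℝ} {L : ℝ} (hL : 0 < L)
    (h1 : ∀ x, HasDerivAt j1 (j1x x) x) (h2 : ∀ x, HasDerivAt j2 (j2x x) x)
    (h3 : ∀ x, HasDerivAt j2x (j2xx x) x) (hc1 : Continuous j1x) (hc3 : Continuous j2xx) :
    ∫ x in (-L)..L, (1 - x ^ 2 / L ^ 2) ^ 2 * (j1x x + j2xx x) =
    ∫ x in (-L)..L, ((-4 / L ^ 2 + 12 * x ^ 2 / L ^ 4) * j2 x
      - (-4 * x / L ^ 2 * (1 - x ^ 2 / L ^ 2)) * j1 x) := by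
  have cj1 : Continuous j1 := continuous_iff_continuousAt.2 fun x => (h1 x).continuousAt
  have cj2 : Continuous j2 := continuous_iff_continuousAt.2 fun x => (h2 x).continuousAt
  have hA : ∀ x, HasDerivAt (fun x : ℝ => (1 - x ^ 2 / L ^ 2)) (-(2 * x / L ^ 2)) x := fun x => by
    have := ((hasDerivAt_pow 2 x).div_const (L ^ 2)).const_sub 1
    simpa using this
  have hχ : ∀ x, HasDerivAt (fun x : ℝ => (1 - x ^ 2 / L ^ 2) ^ 2)
      (-4 * x / L ^ 2 * (1 - x ^ 2 / L ^ 2)) x := fun x => by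
    refine ((hA x).fun_pow 2).congr_deriv ?_
    norm_num; ring
  have hχ' : ∀ x, HasDerivAt (fun x : ℝ => -4 * x / L ^ 2 * (1 - x ^ 2 / L ^ 2))
      (-4 / L ^ 2 + 12 * x ^ 2 / L ^ 4) x := fun x => by
    have h4 : HasDerivAt (fun x : ℝ => -4 * x / L ^ 2) (-4 / L ^ 2) x := by
      simpa using ((hasDerivAt_id x).const_mul (-4)).div_const (L ^ 2)
    refine (h4.fun_mul (hA x)).congr_deriv ?_
    field_simp; ring
  have hF : ∀ x, HasDerivAt (fun x => (1 - x ^ 2 / L ^ 2) ^ 2 * j1 x + (1 - x ^ 2 / L ^ 2) ^ 2 * j2x x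
      - (-4 * x / L ^ 2 * (1 - x ^ 2 / L ^ 2)) * j2 x)
      ((1 - x ^ 2 / L ^ 2) ^ 2 * (j1x x + j2xx x) - ((-4 / L ^ 2 + 12 * x ^ 2 / L ^ 4) * j2 x
      - (-4 * x / L ^ 2 * (1 - x ^ 2 / L ^ 2)) * j1 x)) x := fun x => by
    refine ((((hχ x).fun_mul (h1 x)).fun_add ((hχ x).fun_mul (h3 x))).fun_sub
      ((hχ' x).fun_mul (h2 x))).congr_deriv ?_
    ring
  have c1 : Continuous fun x => (1 - x ^ 2 / L ^ 2) ^ 2 * (j1x x + j2xx x) := by fun_prop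
  have c2 : Continuous fun x => ((-4 / L ^ 2 + 12 * x ^ 2 / L ^ 4) * j2 x
      - (-4 * x / L ^ 2 * (1 - x ^ 2 / L ^ 2)) * j1 x) := by fun_prop
  have := intervalIntegral.integral_eq_sub_of_hasDerivAt (a := -L) (b := L) (fun x _ => hF x)
    ((c1.sub c2).intervalIntegrable _ _)
  rw [intervalIntegral.integral_sub (c1.intervalIntegrable _ _) (c2.intervalIntegrable _ _)] at this
  have hz : 1 - L ^ 2 / L ^ 2 = 0 := by field_simp; simp
  have hz' : 1 - (-L) ^ 2 / L ^ 2 = 0 := by rw [neg_sq]; exact hz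
  rw [hz, hz'] at this
  simp only [ne_eq, OfNat.ofNat_ne_zero, not_false_eq_true, zero_pow, zero_mul, mul_zero, add_zero,
    sub_zero] at this
  linarith

lemma cutoff_bound {j1 j2 s : ℝ → ℝ} {L : ℝ} (hL : 0 < L)
    (h1 : Dec j1) (h2 : Dec j2) (hs : Dec s) :
    |∫ x in (-L)..L, (((-4 / L ^ 2 + 12 * x ^ 2 / L ^ 4) * j2 x
      - (-4 * x / L ^ 2 * (1 - x ^ 2 / L ^ 2)) * j1 x) + (1 - x ^ 2 / L ^ 2) ^ 2 * s x)| ≤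
    8 / L ^ 2 * (∫ x, |j2 x|) + 4 / L * (∫ x, |j1 x|) + ∫ x, |s x| := by
  have hd : Dec (fun x => 8 / L ^ 2 * |j2 x| + 4 / L * |j1 x| + |s x|) :=
    ((h2.abs.const_mul _).add (h1.abs.const_mul _)).add hs.abs
  have e : 8 / L ^ 2 * (∫ x, |j2 x|) + 4 / L * (∫ x, |j1 x|) + ∫ x, |s x| =
      ∫ x, (8 / L ^ 2 * |j2 x| + 4 / L * |j1 x| + |s x|) := by
    rw [integral_add ((h2.abs.const_mul _).add (h1.abs.const_mul _)).integrable hs.abs.integrable,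
      integral_add (h2.abs.const_mul _).integrable (h1.abs.const_mul _).integrable,
      integral_const_mul, integral_const_mul]
  rw [e]
  have hle : -L ≤ L := by linarith
  have hb : ∀ x ∈ Ioc (-L) L, ‖(((-4 / L ^ 2 + 12 * x ^ 2 / L ^ 4) * j2 x
      - (-4 * x / L ^ 2 * (1 - x ^ 2 / L ^ 2)) * j1 x) + (1 - x ^ 2 / L ^ 2) ^ 2 * s x)‖
      ≤ 8 / L ^ 2 * |j2 x| + 4 / L * |j1 x| + |s x| := by
    intro x hx
    have hx2 : x ^ 2 ≤ L ^ 2 := by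
      rw [sq_le_sq, abs_of_pos hL]; exact abs_le.2 ⟨hx.1.le, hx.2⟩
    have hL2 : 0 < L ^ 2 := by positivity
    obtain ⟨y, hy⟩ : ∃ y, y = x / L := ⟨_, rfl⟩
    have hy2 : y ^ 2 ≤ 1 := by rw [hy, div_pow]; exact (div_le_one hL2).2 hx2
    have hy1 : |y| ≤ 1 := (sq_le_one_iff_abs_le_one y).1 hy2
    have e1 : (-4 / L ^ 2 + 12 * x ^ 2 / L ^ 4) = (-4 + 12 * y ^ 2) / L ^ 2 := by
      rw [hy]; field_simp
    have e2 : -4 * x / L ^ 2 * (1 - x ^ 2 / L ^ 2) = -4 / L * (y * (1 - y ^ 2)) := by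
      rw [hy]; field_simp
    have e3 : x ^ 2 / L ^ 2 = y ^ 2 := by rw [hy, div_pow]
    rw [e1, e2, e3, Real.norm_eq_abs]
    have hy0 := sq_nonneg y
    have b1 : |(-4 + 12 * y ^ 2) / L ^ 2| ≤ 8 / L ^ 2 := by
      rw [abs_div, abs_of_pos hL2]
      refine div_le_div_of_nonneg_right ?_ hL2.le
      exact abs_le.2 ⟨by linarith, by linarith⟩
    have b2 : |(-4 / L * (y * (1 - y ^ 2)))| ≤ 4 / L := by
      rw [abs_mul, abs_mul, abs_div, abs_of_pos hL, abs_of_nonneg (by linarith : 0 ≤ 1 - y ^ 2)]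
      have : |y| * (1 - y ^ 2) ≤ 1 := by nlinarith [abs_nonneg y]
      have h4 : (0 : ℝ) ≤ 4 / L := by positivity
      rw [abs_neg, abs_of_pos (by norm_num : (0:ℝ) < 4)]
      exact mul_le_of_le_one_right h4 this
    have b3 : |(1 - y ^ 2) ^ 2| ≤ 1 := by
      rw [abs_of_nonneg (sq_nonneg _)]
      nlinarith
    refine (abs_add_le _ _).trans (add_le_add ((abs_sub _ _).trans (add_le_add ?_ ?_)) ?_)
    · rw [abs_mul]; exact mul_le_mul_of_nonneg_right b1 (abs_nonneg _)
    · rw [abs_mul]; exact mul_le_mul_of_nonneg_right b2 (abs_nonneg _)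
    · rw [abs_mul]; exact mul_le_of_le_one_left (abs_nonneg _) b3
  rw [intervalIntegral.integral_of_le hle, ← Real.norm_eq_abs]
  refine (norm_integral_le_of_norm_le hd.integrable.integrableOn
    ((ae_restrict_iff' measurableSet_Ioc).2 (Eventually.of_forall hb))).trans ?_
  refine setIntegral_le_integral hd.integrable (Eventually.of_forall fun x => ?_)
  simp only [Pi.zero_apply]
  positivity

lemma cutoff_lim {r : ℝ → ℝ} (hr : Dec r) :
    Tendsto (fun n : ℕ => ∫ x in (-((n : ℝ) + 1))..((n : ℝ) + 1), (1 - x ^ 2 / ((n : ℝ) + 1) ^ 2) ^ 2 * r x)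
      atTop (𝓝 (∫ x, r x)) := by
  have hle : ∀ n : ℕ, -((n : ℝ) + 1) ≤ (n : ℝ) + 1 := fun n => by
    have : (0 : ℝ) ≤ n := Nat.cast_nonneg n
    linarith
  simp_rw [intervalIntegral.integral_of_le (hle _), ← integral_indicator measurableSet_Ioc]
  refine tendsto_integral_of_dominated_convergence (fun x => |r x|) ?_ hr.abs.integrable ?_ ?_
  · intro n
    refine AEStronglyMeasurable.indicator ?_ measurableSet_Ioc
    have := hr.cont
    exact (by fun_prop : Continuous fun x => (1 - x ^ 2 / ((n : ℝ) + 1) ^ 2) ^ 2 * r x).aestronglyMeasurable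
  · intro n
    refine Eventually.of_forall fun x => ?_
    rw [indicator_apply]
    split_ifs with hx
    · rw [norm_mul, Real.norm_eq_abs, Real.norm_eq_abs]
      refine mul_le_of_le_one_left (abs_nonneg _) ?_
      have hx2 : x ^ 2 ≤ ((n : ℝ) + 1) ^ 2 := by
        rw [sq_le_sq, abs_of_pos (by positivity : 0 < (n : ℝ) + 1)]
        exact abs_le.2 ⟨hx.1.le, hx.2⟩
      have h1 : x ^ 2 / ((n : ℝ) + 1) ^ 2 ≤ 1 := (div_le_one (by positivity)).2 hx2
      have h0 : 0 ≤ x ^ 2 / ((n : ℝ) + 1) ^ 2 := by positivity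
      rw [abs_of_nonneg (sq_nonneg _)]
      nlinarith
    · simp
  · refine Eventually.of_forall fun x => ?_
    have hn : Tendsto (fun n : ℕ => (n : ℝ) + 1) atTop atTop :=
      tendsto_atTop_add_const_right _ _ tendsto_natCast_atTop_atTop
    have h1 : Tendsto (fun n : ℕ => (1 - x ^ 2 / ((n : ℝ) + 1) ^ 2) ^ 2 * r x) atTop
        (𝓝 ((1 - 0) ^ 2 * r x)) := by
      refine (((tendsto_const_nhds).sub ?_).pow 2).mul_const _
      exact Tendsto.div_atTop tendsto_const_nhds ((tendsto_pow_atTop (by norm_num)).comp hn)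
    rw [sub_zero, one_pow, one_mul] at h1
    refine h1.congr' ?_
    filter_upwards [hn.eventually_gt_atTop |x|] with n hx
    rw [indicator_of_mem]
    have := abs_lt.1 hx
    exact ⟨this.1, this.2.le⟩

theorem balance {ρ ρt j1 j1x j2 j2x j2xx s : ℝ → ℝ → ℝ} {a b C K : ℝ} (hab : a ≤ b)
    (hρ : Continuous (Function.uncurry ρ)) (hρt : Continuous (Function.uncurry ρt))
    (ht : ∀ t x, HasDerivAt (fun t => ρ t x) (ρt t x) t)
    (heq : ∀ t x, ρt t x = j1x t x + j2xx t x + s t x)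
    (h1 : ∀ t x, HasDerivAt (j1 t) (j1x t x) x)
    (h2 : ∀ t x, HasDerivAt (j2 t) (j2x t x) x)
    (h3 : ∀ t x, HasDerivAt (j2x t) (j2xx t x) x)
    (hc1 : ∀ t, Continuous (j1x t)) (hc3 : ∀ t, Continuous (j2xx t))
    (d1 : ∀ t, Dec (j1 t)) (d2 : ∀ t, Dec (j2 t)) (ds : ∀ t, Dec (s t)) (dr : ∀ t, Dec (ρ t))
    (b1 : ∀ t ∈ Icc a b, ∫ x, |j1 t x| ≤ C) (b2 : ∀ t ∈ Icc a b, ∫ x, |j2 t x| ≤ C)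
    (bs : ∀ t ∈ Icc a b, ∫ x, |s t x| ≤ K) :
    |(∫ x, ρ b x) - ∫ x, ρ a x| ≤ K * (b - a) := by
  have key : ∀ L : ℝ, 0 < L → |(∫ x in (-L)..L, (1 - x ^ 2 / L ^ 2) ^ 2 * ρ b x) -
      ∫ x in (-L)..L, (1 - x ^ 2 / L ^ 2) ^ 2 * ρ a x| ≤ (8 / L ^ 2 * C + 4 / L * C + K) * (b - a) := by
    intro L hL
    have hder : ∀ t, HasDerivAt (fun t => ∫ x in (-L)..L, (1 - x ^ 2 / L ^ 2) ^ 2 * ρ t x)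
        (∫ x in (-L)..L, (1 - x ^ 2 / L ^ 2) ^ 2 * ρt t x) t := by
      intro t
      refine leibniz (ρ := fun t x => (1 - x ^ 2 / L ^ 2) ^ 2 * ρ t x)
        (ρt := fun t x => (1 - x ^ 2 / L ^ 2) ^ 2 * ρt t x) ?_ ?_ (fun t x => (ht t x).const_mul _) _ _ t
      · exact Continuous.mul (by fun_prop) hρ
      · exact Continuous.mul (by fun_prop) hρt
    have hbd : ∀ t ∈ Icc a b, ‖∫ x in (-L)..L, (1 - x ^ 2 / L ^ 2) ^ 2 * ρt t x‖ ≤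
        8 / L ^ 2 * C + 4 / L * C + K := by
      intro t htt
      have cj1 : Continuous (j1 t) := (d1 t).cont
      have cj2 : Continuous (j2 t) := (d2 t).cont
      have cs : Continuous (s t) := (ds t).cont
      have i1 := hc1 t
      have i3 := hc3 t
      have e : ∫ x in (-L)..L, (1 - x ^ 2 / L ^ 2) ^ 2 * ρt t x =
          ∫ x in (-L)..L, (((-4 / L ^ 2 + 12 * x ^ 2 / L ^ 4) * j2 t x
      - (-4 * x / L ^ 2 * (1 - x ^ 2 / L ^ 2)) * j1 t x) + (1 - x ^ 2 / L ^ 2) ^ 2 * s t x) := by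
        rw [intervalIntegral.integral_add
          ((by fun_prop : Continuous fun x => ((-4 / L ^ 2 + 12 * x ^ 2 / L ^ 4) * j2 t x
            - (-4 * x / L ^ 2 * (1 - x ^ 2 / L ^ 2)) * j1 t x)).intervalIntegrable _ _)
          ((by fun_prop : Continuous fun x => (1 - x ^ 2 / L ^ 2) ^ 2 * s t x).intervalIntegrable _ _),
          ← cutoff_int hL (h1 t) (h2 t) (h3 t) i1 i3, ← intervalIntegral.integral_add
          ((by fun_prop : Continuous fun x => (1 - x ^ 2 / L ^ 2) ^ 2 * (j1x t x + j2xx t x)).intervalIntegrable _ _)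
          ((by fun_prop : Continuous fun x => (1 - x ^ 2 / L ^ 2) ^ 2 * s t x).intervalIntegrable _ _)]
        refine intervalIntegral.integral_congr fun x _ => ?_
        simp only [heq]; ring
      rw [e, Real.norm_eq_abs]
      refine (cutoff_bound hL (d1 t) (d2 t) (ds t)).trans ?_
      have p1 : 0 ≤ 8 / L ^ 2 := by positivity
      have p2 : 0 ≤ 4 / L := by positivity
      exact add_le_add (add_le_add (mul_le_mul_of_nonneg_left (b2 t htt) p1)
        (mul_le_mul_of_nonneg_left (b1 t htt) p2)) (bs t htt)
    have := (convex_Icc a b).norm_image_sub_le_of_norm_hasDerivWithin_le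
      (fun t _ => (hder t).hasDerivWithinAt) hbd (left_mem_Icc.2 hab) (right_mem_Icc.2 hab)
    rwa [Real.norm_eq_abs, Real.norm_eq_abs, abs_of_nonneg (sub_nonneg.2 hab)] at this
  have hn : Tendsto (fun n : ℕ => (n : ℝ) + 1) atTop atTop :=
    tendsto_atTop_add_const_right _ _ tendsto_natCast_atTop_atTop
  have hl := ((cutoff_lim (dr b)).sub (cutoff_lim (dr a))).abs
  have hr : Tendsto (fun n : ℕ => (8 / ((n : ℝ) + 1) ^ 2 * C + 4 / ((n : ℝ) + 1) * C + K) * (b - a)) atTop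
      (𝓝 ((0 * C + 0 * C + K) * (b - a))) := by
    refine (((Tendsto.mul_const _ ?_).add (Tendsto.mul_const _ ?_)).add_const _).mul_const _
    · exact Tendsto.div_atTop tendsto_const_nhds ((tendsto_pow_atTop (by norm_num)).comp hn)
    · exact Tendsto.div_atTop tendsto_const_nhds hn
  have := le_of_tendsto_of_tendsto' hl hr fun n => key _ (by positivity)
  simpa using this

open MeasureTheory
open Filter Topology Set

/-- Forward average. -/
noncomputable def av (h : ℝ) (f : ℝ → ℝ) (x : ℝ) : ℝ := (∫ y in x..(x + h), f y) / h

lemma av_eq (h : ℝ) (f : ℝ → ℝ) (x : ℝ) : av h f x = (∫ y in (0:ℝ)..h, f (x + y)) / h := by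
  unfold av; rw [intervalIntegral.integral_comp_add_left, add_zero]

lemma av_sup {h S : ℝ} (hh : 0 < h) {f : ℝ → ℝ} {x : ℝ} (hS : ∀ y ∈ Ioc x (x + h), |f y| ≤ S) :
    |av h f x| ≤ S := by
  unfold av
  rw [abs_div, abs_of_pos hh, div_le_iff₀ hh]
  have := intervalIntegral.norm_integral_le_of_norm_le_const (a := x) (b := x + h) (f := f) (C := S)
    (fun y hy => hS y (by rwa [uIoc_of_le (by linarith)] at hy))
  simpa [abs_of_pos hh] using this

lemma av_deriv {h : ℝ} {f : ℝ → ℝ} (hf : Continuous f) (x : ℝ) :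
    HasDerivAt (av h f) ((f (x + h) - f x) / h) x := by
  have h1 : ∀ x, HasDerivAt (fun x => ∫ y in (0:ℝ)..x, f y) (f x) x := fun x =>
    intervalIntegral.integral_hasDerivAt_right (hf.intervalIntegrable _ _)
      hf.stronglyMeasurable.stronglyMeasurableAtFilter hf.continuousAt
  have h2 : HasDerivAt (fun x => ∫ y in (0:ℝ)..(x + h), f y) (f (x + h)) x := by
    have := (h1 (x + h)).comp_add_const x h
    simpa using this
  have e : av h f = fun x => ((∫ y in (0:ℝ)..(x + h), f y) - ∫ y in (0:ℝ)..x, f y) / h := by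
    funext z
    unfold av
    rw [intervalIntegral.integral_interval_sub_left (hf.intervalIntegrable _ _) (hf.intervalIntegrable _ _)]
  rw [e]
  exact (h2.fun_sub (h1 x)).div_const h

lemma av_cont {h : ℝ} {f : ℝ → ℝ} (hf : Continuous f) : Continuous (av h f) :=
  continuous_iff_continuousAt.2 fun x => (av_deriv hf x).continuousAt

lemma av_bound {h C : ℝ} (hh : 0 < h) (h1 : h ≤ 1) {f : ℝ → ℝ} (hC : ∀ x, |f x| * (1 + x ^ 2) ≤ C)
    (x : ℝ) : |av h f x| * (1 + x ^ 2) ≤ 3 * C := by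
  have hC0 : 0 ≤ C := le_trans (by positivity) (hC 0)
  have : |av h f x| ≤ 3 * C * (1 + x ^ 2)⁻¹ := by
    refine av_sup hh fun y hy => ?_
    have hs : |y - x| ≤ 1 := abs_le.2 ⟨by linarith [hy.1], by linarith [hy.2]⟩
    have h2 := Dec.shift_aux (x := x) hs
    rw [add_sub_cancel] at h2
    rw [← div_eq_mul_inv, le_div_iff₀ (by positivity)]
    have h3 := hC y
    have h4 := mul_le_mul_of_nonneg_left h2 (abs_nonneg (f y))
    linarith
  rwa [← div_eq_mul_inv, le_div_iff₀ (by positivity)] at this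

lemma av_dec {h : ℝ} (hh : 0 < h) (h1 : h ≤ 1) {f : ℝ → ℝ} (hf : Dec f) : Dec (av h f) := by
  obtain ⟨hc, C, hC⟩ := hf
  exact ⟨av_cont hc, 3 * C, av_bound hh h1 hC⟩

lemma av_of_deriv {h : ℝ} {f g : ℝ → ℝ} (hf : ∀ x, HasDerivAt f (g x) x) (hg : Continuous g) (x : ℝ) :
    av h g x = (f (x + h) - f x) / h := by
  unfold av
  rw [intervalIntegral.integral_eq_sub_of_hasDerivAt (fun x _ => hf x) (hg.intervalIntegrable _ _)]

lemma cs_interval {f : ℝ → ℝ} (hf : Continuous f) {a b : ℝ} (hab : a ≤ b) :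
    (∫ y in a..b, f y) ^ 2 ≤ (b - a) * ∫ y in a..b, f y ^ 2 := by
  rcases hab.eq_or_lt with rfl | hab'
  · simp
  have hl : 0 < b - a := by linarith
  obtain ⟨m, hm⟩ : ∃ m, m = (∫ y in a..b, f y) / (b - a) := ⟨_, rfl⟩
  have hI : (∫ y in a..b, f y) = m * (b - a) := by rw [hm]; field_simp
  have h0 : 0 ≤ ∫ y in a..b, (f y - m) ^ 2 :=
    intervalIntegral.integral_nonneg hab fun y _ => sq_nonneg _
  have e : ∫ y in a..b, (f y - m) ^ 2 = (∫ y in a..b, f y ^ 2) - 2 * m * (∫ y in a..b, f y) + (b - a) * m ^ 2 := by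
    have : ∀ y, (f y - m) ^ 2 = (f y ^ 2 - 2 * m * f y) + m ^ 2 := fun y => by ring
    simp_rw [this]
    rw [intervalIntegral.integral_add
      ((by fun_prop : Continuous fun y => f y ^ 2 - 2 * m * f y).intervalIntegrable _ _) intervalIntegrable_const,
      intervalIntegral.integral_sub ((by fun_prop : Continuous fun y => f y ^ 2).intervalIntegrable _ _)
      ((by fun_prop : Continuous fun y => 2 * m * f y).intervalIntegrable _ _),
      intervalIntegral.integral_const_mul, intervalIntegral.integral_const, smul_eq_mul]
  rw [e, hI] at h0
  rw [hI]
  have := mul_le_mul_of_nonneg_left (show m ^ 2 * (b - a) ≤ ∫ y in a..b, f y ^ 2 by nlinarith) hl.le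
  nlinarith

lemma interval_le_full {f : ℝ → ℝ} (hf : Dec f) (h0 : ∀ x, 0 ≤ f x) {a b : ℝ} (hab : a ≤ b) :
    (∫ y in a..b, f y) ≤ ∫ y, f y := by
  rw [intervalIntegral.integral_of_le hab]
  exact setIntegral_le_integral hf.integrable (Eventually.of_forall h0)

lemma holder_half {f g : ℝ → ℝ} (hf : ∀ x, HasDerivAt f (g x) x) (hg : Dec g) {x y : ℝ} (hxy : x ≤ y) :
    (f y - f x) ^ 2 ≤ (y - x) * ∫ z, g z ^ 2 := by
  rw [← intervalIntegral.integral_eq_sub_of_hasDerivAt (fun x _ => hf x) (hg.cont.intervalIntegrable _ _)]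
  refine (cs_interval hg.cont hxy).trans (mul_le_mul_of_nonneg_left ?_ (by linarith))
  exact interval_le_full hg.sq (fun x => sq_nonneg _) hxy

lemma av_jensen {h : ℝ} (hh : 0 < h) (h1 : h ≤ 1) {f : ℝ → ℝ} (hf : Dec f) :
    (∫ x, av h f x ^ 2) ≤ ∫ x, f x ^ 2 := by
  have hF := hf.sq
  obtain ⟨hc, C, hC⟩ := hF
  have hle : ∀ x, av h f x ^ 2 ≤ av h (fun y => f y ^ 2) x := by
    intro x
    unfold av
    have := cs_interval hf.cont (a := x) (b := x + h) (by linarith)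
    rw [add_sub_cancel_left] at this
    rw [div_pow, div_le_div_iff₀ (by positivity) hh]
    nlinarith
  refine (integral_mono (av_dec hh h1 hf).sq.integrable (av_dec hh h1 hf.sq).integrable hle).trans
    (le_of_eq ?_)
  simp_rw [av_eq, integral_div, intervalIntegral.integral_of_le hh.le]
  have hInt2 : Integrable (Function.uncurry fun x y => f (x + y) ^ 2)
      (volume.prod (volume.restrict (Ioc 0 h))) := by
    have hb : Integrable (fun p : ℝ × ℝ => 3 * C * (1 + p.1 ^ 2)⁻¹)
        (volume.prod (volume.restrict (Ioc 0 h))) :=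
      (integrable_inv_one_add_sq.const_mul (3 * C)).comp_fst (ν := volume.restrict (Ioc (0:ℝ) h))
    refine hb.mono' ?_ ?_
    · have := hf.cont
      refine Continuous.aestronglyMeasurable ?_
      simp only [Function.uncurry_def]
      fun_prop
    · have : ∀ᵐ p : ℝ × ℝ ∂((volume : Measure ℝ).prod (volume.restrict (Ioc (0:ℝ) h))), p.2 ∈ Ioc (0:ℝ) h := by
        have h5 : ∀ᵐ y ∂(volume.restrict (Ioc (0:ℝ) h)), y ∈ Ioc (0:ℝ) h := ae_restrict_mem measurableSet_Ioc
        exact Measure.quasiMeasurePreserving_snd.ae h5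
      filter_upwards [this] with p hp
      have hs : |p.2| ≤ 1 := abs_le.2 ⟨by linarith [hp.1], by linarith [hp.2]⟩
      have h2 := Dec.shift_aux (x := p.1) hs
      rw [← div_eq_mul_inv, le_div_iff₀ (by positivity)]
      have h3 := hC (p.1 + p.2)
      have h4 := mul_le_mul_of_nonneg_left h2 (abs_nonneg (f (p.1 + p.2) ^ 2))
      simp only [Function.uncurry_def, Real.norm_eq_abs]
      linarith
  rw [integral_integral_swap hInt2]
  have : ∀ y, ∫ x, f (x + y) ^ 2 = ∫ x, f x ^ 2 := fun y =>
    integral_add_right_eq_self (fun x => f x ^ 2) y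
  simp_rw [this]
  rw [integral_const]
  simp [hh.le]
  field_simp

lemma av_tendsto {f : ℝ → ℝ} (hf : Continuous f) (x : ℝ) :
    Tendsto (fun n : ℕ => av (1 / ((n : ℝ) + 1)) f x) atTop (𝓝 (f x)) := by
  have h1 : HasDerivAt (fun z => ∫ y in x..z, f y) (f x) x :=
    intervalIntegral.integral_hasDerivAt_right (hf.intervalIntegrable _ _)
      hf.stronglyMeasurable.stronglyMeasurableAtFilter hf.continuousAt
  rw [hasDerivAt_iff_tendsto_slope_zero] at h1
  have h2 : Tendsto (fun n : ℕ => 1 / ((n : ℝ) + 1)) atTop (𝓝[≠] 0) := by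
    rw [tendsto_nhdsWithin_iff]
    refine ⟨tendsto_one_div_add_atTop_nhds_zero_nat, Eventually.of_forall fun n => ?_⟩
    have : (0 : ℝ) < 1 / ((n : ℝ) + 1) := by positivity
    exact this.ne'
  refine (h1.comp h2).congr fun n => ?_
  simp only [Function.comp, intervalIntegral.integral_same, sub_zero, smul_eq_mul]
  unfold av
  ring

open MeasureTheory
open Filter Topology Set

lemma cont_slice {f : ℝ → ℝ → ℝ} (hf : Continuous (Function.uncurry f)) (t : ℝ) : Continuous (f t) :=
  hf.comp (continuous_const.prodMk continuous_id)

set_option maxHeartbeats 1000000 in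
lemma energy_abs {U q q1 q2 q3 p p1 p2 p3 : ℝ → ℝ → ℝ} {h a b R B K : ℝ} (hab : a ≤ b)
    (hh : 0 < h) (hh1 : h ≤ 1) (hR : 0 ≤ R)
    (cU : Continuous (Function.uncurry U)) (cq : Continuous (Function.uncurry q))
    (cq1 : Continuous (Function.uncurry q1)) (cq2 : Continuous (Function.uncurry q2))
    (cq3 : Continuous (Function.uncurry q3)) (cp : Continuous (Function.uncurry p))
    (cp1 : Continuous (Function.uncurry p1)) (cp2 : Continuous (Function.uncurry p2))
    (cp3 : Continuous (Function.uncurry p3))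
    (dU : ∀ t x, HasDerivAt (U t) (q t x) x) (dq : ∀ t x, HasDerivAt (q t) (q1 t x) x)
    (dq1 : ∀ t x, HasDerivAt (q1 t) (q2 t x) x) (dq2 : ∀ t x, HasDerivAt (q2 t) (q3 t x) x)
    (dp : ∀ t x, HasDerivAt (p t) (p1 t x) x) (dp1 : ∀ t x, HasDerivAt (p1 t) (p2 t x) x)
    (dp2 : ∀ t x, HasDerivAt (p2 t) (p3 t x) x)
    (tU : ∀ t x, HasDerivAt (fun t => U t x) (-q2 t x - p t x * q t x) t)
    (tq : ∀ t x, HasDerivAt (fun t => q t x) (-q3 t x - (p1 t x * q t x + p t x * q1 t x)) t)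
    (tp : ∀ t x, HasDerivAt (fun t => p t x) (-p3 t x - (p t x * p1 t x + h ^ 2 * (q t x * q1 t x) / 4)) t)
    (eU : ∀ t, Dec (U t)) (eq : ∀ t, Dec (q t)) (eq1 : ∀ t, Dec (q1 t)) (ep : ∀ t, Dec (p t))
    (ep1 : ∀ t, Dec (p1 t))
    (bU : ∀ t ∈ Icc a b, ∀ x, |U t x| ≤ R) (bp : ∀ t ∈ Icc a b, ∀ x, |p t x| ≤ R)
    (bB : ∀ t ∈ Icc a b, ∫ x, (p t x ^ 2 + q t x ^ 2 + q1 t x ^ 2 + p1 t x ^ 2 + U t x ^ 2) ≤ B)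
    (bK : ∀ t ∈ Icc a b, ∫ x, |1 / 3 * (p t x ^ 2 - U t x ^ 2) * (U t x * q t x)
      - h ^ 2 / 12 * q t x ^ 3 * U t x| ≤ K) :
    |(∫ x, (q b x ^ 2 - p b x * U b x ^ 2 / 3)) - ∫ x, (q a x ^ 2 - p a x * U a x ^ 2 / 3)| ≤ K * (b - a) := by
  have eE : ∀ t, Dec (fun x => p t x ^ 2 + q t x ^ 2 + q1 t x ^ 2 + p1 t x ^ 2 + U t x ^ 2) := fun t =>
    ((((ep t).sq.add (eq t).sq).add (eq1 t).sq).add (ep1 t).sq).add (eU t).sq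
  have cU' := fun t => cont_slice cU t
  have cq' := fun t => cont_slice cq t
  have cq1' := fun t => cont_slice cq1 t
  have cq2' := fun t => cont_slice cq2 t
  have cq3' := fun t => cont_slice cq3 t
  have cp' := fun t => cont_slice cp t
  have cp1' := fun t => cont_slice cp1 t
  have cp2' := fun t => cont_slice cp2 t
  have cp3' := fun t => cont_slice cp3 t
  -- Decay helper
  have dd : ∀ t, Dec (fun x => 3 * q1 t x ^ 2 - p t x * q t x ^ 2 + 1 / 3 * (-4 * (p1 t x * (U t x * q t x))
      + 2 * (p t x * (U t x * q1 t x)) - p t x * q t x ^ 2) + 1 / 6 * ((p t x ^ 2 + h ^ 2 / 4 * q t x ^ 2) * U t x ^ 2)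
      + 1 / 12 * (U t x ^ 2 * U t x ^ 2)) := fun t =>
    (((((eq1 t).sq.const_mul 3).sub ((ep t).mul (eq t).sq)).add
      ((((((ep1 t).mul ((eU t).mul (eq t))).const_mul (-4)).add
        (((ep t).mul ((eU t).mul (eq1 t))).const_mul 2)).sub ((ep t).mul (eq t).sq)).const_mul _)).add
      ((((ep t).sq.add ((eq t).sq.const_mul _)).mul (eU t).sq).const_mul _)).add
      (((eU t).sq.mul (eU t).sq).const_mul _)
  have dd2 : ∀ t, Dec (fun x => -2 * (q t x * q1 t x) + 1 / 3 * (p1 t x * U t x ^ 2)) := fun t =>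
    (((eq t).mul (eq1 t)).const_mul _).add (((ep1 t).mul (eU t).sq).const_mul _)
  have ds : ∀ t, Dec (fun x => 1 / 3 * (p t x ^ 2 - U t x ^ 2) * (U t x * q t x)
      - h ^ 2 / 12 * q t x ^ 3 * U t x) := fun t =>
    ((((ep t).sq.sub (eU t).sq).const_mul _).mul ((eU t).mul (eq t))).sub
      (((eq t).cube.const_mul _).mul (eU t))
  refine balance (C := (3 + 5 * R + 3 * R ^ 2) * B) (K := K) hab
    (ρ := fun t x => q t x ^ 2 - p t x * U t x ^ 2 / 3)
    (ρt := fun t x => 2 * q t x * (-q3 t x - (p1 t x * q t x + p t x * q1 t x))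
      - ((-p3 t x - (p t x * p1 t x + h ^ 2 * (q t x * q1 t x) / 4)) * U t x ^ 2
        + p t x * (2 * U t x * (-q2 t x - p t x * q t x))) / 3)
    (j1 := fun t x => 3 * q1 t x ^ 2 - p t x * q t x ^ 2 + 1 / 3 * (-4 * (p1 t x * (U t x * q t x))
      + 2 * (p t x * (U t x * q1 t x)) - p t x * q t x ^ 2) + 1 / 6 * ((p t x ^ 2 + h ^ 2 / 4 * q t x ^ 2) * U t x ^ 2)
      + 1 / 12 * (U t x ^ 2 * U t x ^ 2))
    (j1x := fun t x => 6 * q1 t x * q2 t x - (p1 t x * q t x ^ 2 + 2 * p t x * q t x * q1 t x)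
      + 1 / 3 * (-4 * (p2 t x * U t x * q t x + p1 t x * q t x * q t x + p1 t x * U t x * q1 t x)
        + 2 * (p1 t x * U t x * q1 t x + p t x * q t x * q1 t x + p t x * U t x * q2 t x)
        - (p1 t x * q t x ^ 2 + 2 * p t x * q t x * q1 t x))
      + 1 / 6 * ((2 * p t x * p1 t x + h ^ 2 / 4 * (2 * q t x * q1 t x)) * U t x ^ 2
        + (p t x ^ 2 + h ^ 2 / 4 * q t x ^ 2) * (2 * U t x * q t x)) + 1 / 3 * U t x ^ 3 * q t x)
    (j2 := fun t x => -2 * (q t x * q1 t x) + 1 / 3 * (p1 t x * U t x ^ 2))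
    (j2x := fun t x => -2 * (q1 t x * q1 t x + q t x * q2 t x) + 1 / 3 * (p2 t x * U t x ^ 2
      + p1 t x * (2 * U t x * q t x)))
    (j2xx := fun t x => -2 * (3 * q1 t x * q2 t x + q t x * q3 t x) + 1 / 3 * (p3 t x * U t x ^ 2
      + p2 t x * (2 * U t x * q t x) + 2 * (p2 t x * U t x * q t x + p1 t x * q t x * q t x + p1 t x * U t x * q1 t x)))
    (s := fun t x => 1 / 3 * (p t x ^ 2 - U t x ^ 2) * (U t x * q t x)
      - h ^ 2 / 12 * q t x ^ 3 * U t x)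
    ?_ ?_ ?_ ?_ ?_ ?_ ?_ ?_ ?_ dd dd2 ds ?_ ?_ ?_ bK
  · simp only [Function.uncurry_def] at *; fun_prop
  · simp only [Function.uncurry_def] at *; fun_prop
  · intro t x
    refine (((tq t x).fun_pow 2).fun_sub (((tp t x).fun_mul ((tU t x).fun_pow 2)).div_const 3)).congr_deriv ?_
    norm_num
  · intro t x; ring
  · intro t x
    have hU := dU t x
    have hq := dq t x
    have hq1 := dq1 t x
    have hp := dp t x
    have hp1 := dp1 t x
    have hU2 := hU.fun_pow 2
    refine ((((((hq1.fun_pow 2).const_mul 3).fun_sub (hp.fun_mul (hq.fun_pow 2))).fun_add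
      ((((((hp1.fun_mul (hU.fun_mul hq)).const_mul (-4)).fun_add
        ((hp.fun_mul (hU.fun_mul hq1)).const_mul 2)).fun_sub (hp.fun_mul (hq.fun_pow 2))).const_mul (1 / 3)))).fun_add
      ((((hp.fun_pow 2).fun_add ((hq.fun_pow 2).const_mul (h ^ 2 / 4))).fun_mul hU2).const_mul (1 / 6))).fun_add
      ((hU2.fun_mul hU2).const_mul (1 / 12))).congr_deriv ?_
    norm_num
    ring
  · intro t x
    refine ((((dq t x).fun_mul (dq1 t x)).const_mul (-2)).fun_add
      (((dp1 t x).fun_mul ((dU t x).fun_pow 2)).const_mul (1 / 3))).congr_deriv ?_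
    norm_num
  · intro t x
    refine (((((dq1 t x).fun_mul (dq1 t x)).fun_add ((dq t x).fun_mul (dq2 t x))).const_mul (-2)).fun_add
      ((((dp2 t x).fun_mul ((dU t x).fun_pow 2)).fun_add ((dp1 t x).fun_mul (((dU t x).const_mul 2).fun_mul (dq t x)))).const_mul (1 / 3))).congr_deriv ?_
    norm_num
    ring
  · intro t; fun_prop
  · intro t; fun_prop
  · intro t
    exact (eq t).sq.sub (((ep t).mul (eU t).sq).div_const 3)
  · intro t ht
    refine le_trans ?_ (mul_le_mul_of_nonneg_left (bB t ht) (by positivity))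
    rw [← integral_const_mul]
    refine integral_mono (dd t).abs.integrable ((eE t).const_mul _).integrable fun x => ?_
    have hU := bU t ht x
    have hp := bp t ht x
    simp only
    generalize U t x = U at *
    generalize p t x = p at *
    generalize q t x = q at *
    generalize q1 t x = q1 at *
    generalize p1 t x = p1 at *
    have hU0 := abs_nonneg U
    have hp0 := abs_nonneg p
    obtain ⟨E, hE⟩ : ∃ E, E = p ^ 2 + q ^ 2 + q1 ^ 2 + p1 ^ 2 + U ^ 2 := ⟨_, rfl⟩
    have sp := sq_nonneg p
    have sq' := sq_nonneg q
    have sq1 := sq_nonneg q1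
    have sp1 := sq_nonneg p1
    have sU := sq_nonneg U
    have hE0 : 0 ≤ E := by rw [hE]; positivity
    have hq2E : q ^ 2 ≤ E := by rw [hE]; linarith
    have hU2E : U ^ 2 ≤ E := by rw [hE]; linarith
    have hpR : p ^ 2 ≤ R ^ 2 := sq_le_sq' (by linarith [(abs_le.1 hp).1]) (abs_le.1 hp).2
    have hUR : U ^ 2 ≤ R ^ 2 := sq_le_sq' (by linarith [(abs_le.1 hU).1]) (abs_le.1 hU).2
    have t1 : |3 * q1 ^ 2| ≤ 3 * E := by rw [abs_of_nonneg (by positivity), hE]; linarith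
    have t2 : |p * q ^ 2| ≤ R * E := by
      rw [abs_mul, abs_of_nonneg sq']; exact mul_le_mul hp hq2E sq' hR
    have t3 : |p1 * (U * q)| ≤ R * (E / 2) := by
      have : p1 * (U * q) = U * (p1 * q) := by ring
      rw [this, abs_mul]
      refine mul_le_mul hU ?_ (abs_nonneg _) hR
      rw [hE]
      exact abs_le.2 ⟨by nlinarith [sq_nonneg (p1 + q)], by nlinarith [sq_nonneg (p1 - q)]⟩
    have t4 : |p * (U * q1)| ≤ R * (E / 2) := by
      rw [abs_mul]
      refine mul_le_mul hp ?_ (abs_nonneg _) hR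
      rw [hE]
      exact abs_le.2 ⟨by nlinarith [sq_nonneg (U + q1)], by nlinarith [sq_nonneg (U - q1)]⟩
    have hh2 : h ^ 2 ≤ 1 := pow_le_one₀ hh.le hh1
    have hhq : h ^ 2 * q ^ 2 ≤ q ^ 2 := mul_le_of_le_one_left sq' hh2
    have hpq : p ^ 2 + h ^ 2 / 4 * q ^ 2 ≤ E := by rw [hE]; linarith
    have t5 : |(p ^ 2 + h ^ 2 / 4 * q ^ 2) * U ^ 2| ≤ E * R ^ 2 := by
      rw [abs_of_nonneg (by positivity)]; exact mul_le_mul hpq hUR sU hE0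
    have t6 : |U ^ 2 * U ^ 2| ≤ E * R ^ 2 := by
      rw [abs_of_nonneg (by positivity)]; exact mul_le_mul hU2E hUR sU hE0
    rw [← hE]
    have hRE : 0 ≤ R * E := by positivity
    have hRE2 : 0 ≤ E * R ^ 2 := by positivity
    rw [abs_le] at *
    have e : (3 + 5 * R + 3 * R ^ 2) * E = 3 * E + 5 * (R * E) + 3 * (E * R ^ 2) := by ring
    rw [e]
    constructor <;> linarith
  · intro t ht
    refine le_trans ?_ (mul_le_mul_of_nonneg_left (bB t ht) (by positivity))
    rw [← integral_const_mul]
    refine integral_mono (dd2 t).abs.integrable ((eE t).const_mul _).integrable fun x => ?_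
    have hU := bU t ht x
    simp only
    generalize U t x = U at *
    generalize p t x = p at *
    generalize q t x = q at *
    generalize q1 t x = q1 at *
    generalize p1 t x = p1 at *
    obtain ⟨E, hE⟩ : ∃ E, E = p ^ 2 + q ^ 2 + q1 ^ 2 + p1 ^ 2 + U ^ 2 := ⟨_, rfl⟩
    have sp := sq_nonneg p
    have sq' := sq_nonneg q
    have sq1 := sq_nonneg q1
    have sp1 := sq_nonneg p1
    have sU := sq_nonneg U
    have hE0 : 0 ≤ E := by rw [hE]; positivity
    have t1 : |q * q1| ≤ E / 2 := by
      rw [hE]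
      exact abs_le.2 ⟨by nlinarith [sq_nonneg (q + q1)], by nlinarith [sq_nonneg (q - q1)]⟩
    have t3 : |p1 * U ^ 2| ≤ R * (E / 2) := by
      have : p1 * U ^ 2 = U * (p1 * U) := by ring
      rw [this, abs_mul]
      refine mul_le_mul hU ?_ (abs_nonneg _) hR
      rw [hE]
      exact abs_le.2 ⟨by nlinarith [sq_nonneg (p1 + U)], by nlinarith [sq_nonneg (p1 - U)]⟩
    rw [← hE]
    have hRE : 0 ≤ R * E := by positivity
    have hRE2 : 0 ≤ E * R ^ 2 := by positivity
    rw [abs_le] at *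
    have e : (3 + 5 * R + 3 * R ^ 2) * E = 3 * E + 5 * (R * E) + 3 * (E * R ^ 2) := by ring
    rw [e]
    constructor <;> linarith

open MeasureTheory
open Filter Topology Set

/-- A smooth decaying KdV solution, with its spatial derivatives. -/
structure Sol (u u1 u2 u3 : ℝ → ℝ → ℝ) : Prop where
  c0 : Continuous (Function.uncurry u)
  c1 : Continuous (Function.uncurry u1)
  c2 : Continuous (Function.uncurry u2)
  c3 : Continuous (Function.uncurry u3)
  d0 : ∀ t x, HasDerivAt (u t) (u1 t x) x
  d1 : ∀ t x, HasDerivAt (u1 t) (u2 t x) x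
  d2 : ∀ t x, HasDerivAt (u2 t) (u3 t x) x
  dt : ∀ t x, HasDerivAt (fun t => u t x) (-(u t x * u1 t x) - u3 t x) t
  e0 : ∀ t, Dec (u t)
  e1 : ∀ t, Dec (u1 t)
  e2 : ∀ t, Dec (u2 t)
  e3 : ∀ t, Dec (u3 t)

namespace Sol

variable {u u1 u2 u3 : ℝ → ℝ → ℝ}

lemma sup (hu : Sol u u1 u2 u3) {t B : ℝ} (hB : ∫ x, (u t x ^ 2 + u1 t x ^ 2) ≤ B) (x : ℝ) :
    |u t x| ≤ Real.sqrt B :=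
  Real.abs_le_sqrt (((hu.e0 t).sup_bound (hu.e1 t) (hu.d0 t) x).trans hB)

lemma int_le (hu : Sol u u1 u2 u3) {t B c : ℝ} (hc : 0 ≤ c)
    (hB : ∫ x, (u t x ^ 2 + u1 t x ^ 2) ≤ B) {f : ℝ → ℝ} (hf : Dec f)
    (hle : ∀ x, |f x| ≤ c * (u t x ^ 2 + u1 t x ^ 2)) : ∫ x, |f x| ≤ c * B := by
  refine le_trans ?_ (mul_le_mul_of_nonneg_left hB hc)
  rw [← integral_const_mul]
  exact integral_mono hf.abs.integrable ((((hu.e0 t).sq.add (hu.e1 t).sq)).const_mul _).integrable hle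

lemma mass_loc (hu : Sol u u1 u2 u3) {a b B : ℝ} (hab : a ≤ b)
    (hB : ∀ t ∈ Icc a b, ∫ x, (u t x ^ 2 + u1 t x ^ 2) ≤ B) :
    ∫ x, u b x ^ 2 = ∫ x, u a x ^ 2 := by
  have c0 := hu.c0
  have c1 := hu.c1
  have c3 := hu.c3
  have k0 := fun t => cont_slice hu.c0 t
  have k1 := fun t => cont_slice hu.c1 t
  have k2 := fun t => cont_slice hu.c2 t
  have k3 := fun t => cont_slice hu.c3 t
  have dj1 : ∀ t, Dec (fun x => -2 / 3 * u t x ^ 3 + 3 * u1 t x ^ 2) := fun t =>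
    ((hu.e0 t).cube.const_mul _).add ((hu.e1 t).sq.const_mul _)
  have dj2 : ∀ t, Dec (fun x => -2 * (u t x * u1 t x)) := fun t =>
    (((hu.e0 t).mul (hu.e1 t)).const_mul _)
  have hs := Real.sqrt_nonneg B
  have := balance (C := (3 + Real.sqrt B) * B) (K := 0) hab
    (ρ := fun t x => u t x ^ 2)
    (ρt := fun t x => 2 * u t x * (-(u t x * u1 t x) - u3 t x))
    (j1 := fun t x => -2 / 3 * u t x ^ 3 + 3 * u1 t x ^ 2)
    (j1x := fun t x => -2 / 3 * (3 * u t x ^ 2 * u1 t x) + 3 * (2 * u1 t x * u2 t x))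
    (j2 := fun t x => -2 * (u t x * u1 t x))
    (j2x := fun t x => -2 * (u1 t x * u1 t x + u t x * u2 t x))
    (j2xx := fun t x => -2 * (3 * (u1 t x * u2 t x) + u t x * u3 t x))
    (s := fun _ _ => 0)
    (by simp only [Function.uncurry_def] at *; fun_prop)
    (by simp only [Function.uncurry_def] at *; fun_prop)
    (fun t x => ((hu.dt t x).fun_pow 2).congr_deriv (by norm_num))
    (fun t x => by ring)
    (fun t x => ((((hu.d0 t x).fun_pow 3).const_mul (-2 / 3)).fun_add
      (((hu.d1 t x).fun_pow 2).const_mul 3)).congr_deriv (by norm_num))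
    (fun t x => (((hu.d0 t x).fun_mul (hu.d1 t x)).const_mul (-2)).congr_deriv (by ring))
    (fun t x => ((((hu.d1 t x).fun_mul (hu.d1 t x)).fun_add
      ((hu.d0 t x).fun_mul (hu.d2 t x))).const_mul (-2)).congr_deriv (by ring))
    (fun t => by fun_prop) (fun t => by fun_prop)
    dj1 dj2 (fun t => by simpa using (hu.e0 t).const_mul 0) (fun t => (hu.e0 t).sq)
    (fun t ht => hu.int_le (by positivity) (hB t ht) (dj1 t) fun x => by
      have h1 := hu.sup (hB t ht) x
      have h2 : |u t x ^ 3| ≤ Real.sqrt B * u t x ^ 2 := by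
        rw [show u t x ^ 3 = u t x * u t x ^ 2 by ring, abs_mul, abs_of_nonneg (sq_nonneg (u t x))]
        exact mul_le_mul_of_nonneg_right h1 (sq_nonneg _)
      have h3 := mul_nonneg hs (sq_nonneg (u t x))
      have h4 := mul_nonneg hs (sq_nonneg (u1 t x))
      have h5 := sq_nonneg (u1 t x)
      have h6 := sq_nonneg (u t x)
      rw [abs_le] at *
      constructor <;> linarith)
    (fun t ht => hu.int_le (by positivity) (hB t ht) (dj2 t) fun x => by
      have h3 := mul_nonneg hs (sq_nonneg (u t x))
      have h4 := mul_nonneg hs (sq_nonneg (u1 t x))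
      rw [abs_le]
      constructor <;> nlinarith [sq_nonneg (u t x + u1 t x), sq_nonneg (u t x - u1 t x)])
    (fun t ht => by simp)
  rw [zero_mul] at this
  exact sub_eq_zero.1 (abs_eq_zero.1 (le_antisymm this (abs_nonneg _)))

set_option maxHeartbeats 1000000 in
lemma energy_step (hu : Sol u u1 u2 u3) {a b B h : ℝ} (hab : a ≤ b) (hh : 0 < h) (hh1 : h ≤ 1)
    (hB : ∀ t ∈ Icc a b, ∫ x, (u t x ^ 2 + u1 t x ^ 2) ≤ B) :
    |(∫ x, (av h (u1 b) x ^ 2 - (u b (x + h) + u b x) / 2 * av h (u b) x ^ 2 / 3)) -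
      ∫ x, (av h (u1 a) x ^ 2 - (u a (x + h) + u a x) / 2 * av h (u a) x ^ 2 / 3)| ≤
      ((4 / 3 * (Real.sqrt (h * B) * Real.sqrt B) + h * B / 12) * B) * (b - a) := by
  have hB0 : 0 ≤ B := le_trans (integral_nonneg fun x => by positivity) (hB a (left_mem_Icc.2 hab))
  have hs := Real.sqrt_nonneg B
  have hhB : 0 ≤ h * B := by positivity
  have c0 := hu.c0
  have c1 := hu.c1
  have c2 := hu.c2
  have c3 := hu.c3
  have k0 := fun t => cont_slice hu.c0 t
  have k1 := fun t => cont_slice hu.c1 t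
  have k2 := fun t => cont_slice hu.c2 t
  have k3 := fun t => cont_slice hu.c3 t
  have hq : ∀ t x, av h (u1 t) x = (u t (x + h) - u t x) / h := fun t x =>
    av_of_deriv (hu.d0 t) (k1 t) x
  have sh : ∀ {f g : ℝ → ℝ → ℝ}, (∀ t x, HasDerivAt (f t) (g t x) x) →
      ∀ t x, HasDerivAt (fun x => f t (x + h)) (g t (x + h)) x := fun hf t x =>
    (hf t (x + h)).comp_add_const x h
  have eq : ∀ t, Dec (fun x => (u t (x + h) - u t x) / h) := fun t =>
    (((hu.e0 t).shift h).sub (hu.e0 t)).div_const h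
  have eq1 : ∀ t, Dec (fun x => (u1 t (x + h) - u1 t x) / h) := fun t =>
    (((hu.e1 t).shift h).sub (hu.e1 t)).div_const h
  have ep : ∀ t, Dec (fun x => (u t (x + h) + u t x) / 2) := fun t =>
    (((hu.e0 t).shift h).add (hu.e0 t)).div_const 2
  have ep1 : ∀ t, Dec (fun x => (u1 t (x + h) + u1 t x) / 2) := fun t =>
    (((hu.e1 t).shift h).add (hu.e1 t)).div_const 2
  have eU : ∀ t, Dec (av h (u t)) := fun t => av_dec hh hh1 (hu.e0 t)
  have tsh : ∀ t x, HasDerivAt (fun t => u t (x + h)) (-(u t (x + h) * u1 t (x + h)) - u3 t (x + h)) t :=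
    fun t x => hu.dt t (x + h)
  have hU2 : ∀ t ∈ Icc a b, (∫ x, av h (u t) x ^ 2) + (∫ x, av h (u1 t) x ^ 2) ≤ B := fun t ht => by
    have h1 := av_jensen hh hh1 (hu.e0 t)
    have h2 := av_jensen hh hh1 (hu.e1 t)
    have h3 := hB t ht
    rw [integral_add (hu.e0 t).sq.integrable (hu.e1 t).sq.integrable] at h3
    linarith
  have hK1 : ∀ t ∈ Icc a b, ∫ x, u1 t x ^ 2 ≤ B := fun t ht => by
    have h3 := hB t ht
    rw [integral_add (hu.e0 t).sq.integrable (hu.e1 t).sq.integrable] at h3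
    have : 0 ≤ ∫ x, u t x ^ 2 := integral_nonneg fun x => by positivity
    linarith
  have hSh : ∀ t ∈ Icc a b, ∫ x, (u t (x + h) ^ 2 + u1 t (x + h) ^ 2) ≤ B := fun t ht => by
    rw [integral_add_right_eq_self (fun x => u t x ^ 2 + u1 t x ^ 2) h]
    exact hB t ht
  have hhol : ∀ t ∈ Icc a b, ∀ x, ∀ y ∈ Icc x (x + h), |u t y - u t x| ≤ Real.sqrt (h * B) := by
    intro t ht x y hy
    refine Real.abs_le_sqrt ((holder_half (hu.d0 t) (hu.e1 t) hy.1).trans ?_)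
    exact mul_le_mul (by linarith [hy.2]) (hK1 t ht) (integral_nonneg fun x => by positivity) hh.le
  have main := energy_abs (h := h) (a := a) (b := b) (R := Real.sqrt B)
    (B := (2 + 2 / h ^ 2) * (2 * B) + B)
    (K := (4 / 3 * (Real.sqrt (h * B) * Real.sqrt B) + h * B / 12) * B)
    (U := fun t x => av h (u t) x) (q := fun t x => (u t (x + h) - u t x) / h)
    (q1 := fun t x => (u1 t (x + h) - u1 t x) / h) (q2 := fun t x => (u2 t (x + h) - u2 t x) / h)
    (q3 := fun t x => (u3 t (x + h) - u3 t x) / h) (p := fun t x => (u t (x + h) + u t x) / 2)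
    (p1 := fun t x => (u1 t (x + h) + u1 t x) / 2) (p2 := fun t x => (u2 t (x + h) + u2 t x) / 2)
    (p3 := fun t x => (u3 t (x + h) + u3 t x) / 2) hab hh hh1 hs
    (by
      simp only [av_eq, Function.uncurry_def]
      refine Continuous.div_const ?_ _
      refine intervalIntegral.continuous_parametric_intervalIntegral_of_continuous'
        (f := fun (p : ℝ × ℝ) y => u p.1 (p.2 + y)) ?_ 0 h
      simp only [Function.uncurry_def] at *
      fun_prop)
    (by simp only [Function.uncurry_def] at *; fun_prop)
    (by simp only [Function.uncurry_def] at *; fun_prop)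
    (by simp only [Function.uncurry_def] at *; fun_prop)
    (by simp only [Function.uncurry_def] at *; fun_prop)
    (by simp only [Function.uncurry_def] at *; fun_prop)
    (by simp only [Function.uncurry_def] at *; fun_prop)
    (by simp only [Function.uncurry_def] at *; fun_prop)
    (by simp only [Function.uncurry_def] at *; fun_prop)
    (fun t x => av_deriv (k0 t) x)
    (fun t x => ((sh hu.d0 t x).fun_sub (hu.d0 t x)).div_const h)
    (fun t x => ((sh hu.d1 t x).fun_sub (hu.d1 t x)).div_const h)
    (fun t x => ((sh hu.d2 t x).fun_sub (hu.d2 t x)).div_const h)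
    (fun t x => ((sh hu.d0 t x).fun_add (hu.d0 t x)).div_const 2)
    (fun t x => ((sh hu.d1 t x).fun_add (hu.d1 t x)).div_const 2)
    (fun t x => ((sh hu.d2 t x).fun_add (hu.d2 t x)).div_const 2)
    (by
      intro t x
      have h1 := (leibniz (ρ := u) (ρt := fun t x => -(u t x * u1 t x) - u3 t x) c0
        (by simp only [Function.uncurry_def] at *; fun_prop) hu.dt x (x + h) t).div_const h
      refine h1.congr_deriv ?_
      have hF : ∀ y, HasDerivAt (fun y => -(1 / 2 * u t y ^ 2) - u2 t y) (-(u t y * u1 t y) - u3 t y) y :=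
        fun y => ((((hu.d0 t y).fun_pow 2).const_mul (1 / 2)).fun_neg.fun_sub (hu.d2 t y)).congr_deriv
          (by norm_num; ring)
      rw [intervalIntegral.integral_eq_sub_of_hasDerivAt (fun y _ => hF y)
        ((by have := k0 t; have := k1 t; have := k3 t; fun_prop :
          Continuous fun y => -(u t y * u1 t y) - u3 t y).intervalIntegrable _ _)]
      field_simp
      ring)
    (fun t x => (((tsh t x).fun_sub (hu.dt t x)).div_const h).congr_deriv (by field_simp; ring))
    (fun t x => (((tsh t x).fun_add (hu.dt t x)).div_const 2).congr_deriv (by field_simp; ring))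
    eU eq eq1 ep ep1
    (fun t ht x => av_sup hh fun y _ => hu.sup (hB t ht) y)
    (fun t ht x => by
      have h1 := hu.sup (hB t ht) x
      have h2 := hu.sup (hB t ht) (x + h)
      rw [abs_le] at *
      constructor <;> linarith)
    ?_ ?_
  · simp only [hq]
    exact main
  · intro t ht
    have hle : ∀ x, ((u t (x + h) + u t x) / 2) ^ 2 + ((u t (x + h) - u t x) / h) ^ 2 + ((u1 t (x + h) - u1 t x) / h) ^ 2
        + ((u1 t (x + h) + u1 t x) / 2) ^ 2 + av h (u t) x ^ 2 ≤
        (2 + 2 / h ^ 2) * ((u t x ^ 2 + u1 t x ^ 2) + (u t (x + h) ^ 2 + u1 t (x + h) ^ 2)) + av h (u t) x ^ 2 := by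
      intro x
      generalize u t (x + h) = A
      generalize u t x = A'
      generalize u1 t (x + h) = D
      generalize u1 t x = D'
      have hi : 0 ≤ 1 / h ^ 2 := by positivity
      have e1 : ((A - A') / h) ^ 2 = 1 / h ^ 2 * (A - A') ^ 2 := by field_simp
      have e2 : ((D - D') / h) ^ 2 = 1 / h ^ 2 * (D - D') ^ 2 := by field_simp
      have e3 : 2 / h ^ 2 = 2 * (1 / h ^ 2) := by ring
      rw [e1, e2, e3]
      have f1 := mul_nonneg hi (sq_nonneg (A + A'))
      have f2 := mul_nonneg hi (sq_nonneg (D + D'))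
      nlinarith [sq_nonneg (A - A'), sq_nonneg (D - D'), sq_nonneg A, sq_nonneg A', sq_nonneg D, sq_nonneg D']
    have dd := ((((ep t).sq.add (eq t).sq).add (eq1 t).sq).add (ep1 t).sq).add (eU t).sq
    have dE := (hu.e0 t).sq.add (hu.e1 t).sq
    have dE' := dE.shift h
    refine (integral_mono dd.integrable (((dE.add dE').const_mul _).add (eU t).sq).integrable hle).trans ?_
    rw [integral_add ((dE.add dE').const_mul _).integrable (eU t).sq.integrable, integral_const_mul,
      integral_add dE.integrable dE'.integrable]
    have h1 := hU2 t ht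
    have h2 := hB t ht
    have h3 := hSh t ht
    have h4 : 0 ≤ ∫ x, av h (u1 t) x ^ 2 := integral_nonneg fun x => by positivity
    refine add_le_add (mul_le_mul_of_nonneg_left (by linarith) (by positivity)) (by linarith)
  · intro t ht
    have hη := Real.sqrt_nonneg (h * B)
    have hη2 := Real.sq_sqrt hhB
    have ds : Dec (fun x => 1 / 3 * (((u t (x + h) + u t x) / 2) ^ 2 - av h (u t) x ^ 2) * (av h (u t) x * ((u t (x + h) - u t x) / h))
      - h ^ 2 / 12 * ((u t (x + h) - u t x) / h) ^ 3 * av h (u t) x) :=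
      ((((ep t).sq.sub (eU t).sq).const_mul _).mul ((eU t).mul (eq t))).sub
      (((eq t).cube.const_mul _).mul (eU t))
    have dq2 : Dec (fun x => av h (u t) x ^ 2 + av h (u1 t) x ^ 2) :=
      (eU t).sq.add (av_dec hh hh1 (hu.e1 t)).sq
    have hfin : ∫ x, (av h (u t) x ^ 2 + av h (u1 t) x ^ 2) ≤ B := by
      rw [integral_add (eU t).sq.integrable (av_dec hh hh1 (hu.e1 t)).sq.integrable]
      exact hU2 t ht
    refine le_trans ?_ (mul_le_mul_of_nonneg_left hfin (by positivity))
    rw [← integral_const_mul]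
    refine integral_mono ds.abs.integrable (dq2.const_mul _).integrable fun x => ?_
    simp only
    have b1 := hu.sup (hB t ht) x
    have b2 := hu.sup (hB t ht) (x + h)
    have b3 : |av h (u t) x| ≤ Real.sqrt B := av_sup hh fun y _ => hu.sup (hB t ht) y
    have b4 := hhol t ht x (x + h) (right_mem_Icc.2 (by linarith))
    have b5 : |av h (u t) x - u t x| ≤ Real.sqrt (h * B) := by
      have e : av h (u t) x - u t x = av h (fun y => u t y - u t x) x := by
        unfold av
        rw [intervalIntegral.integral_sub ((k0 t).intervalIntegrable _ _) intervalIntegrable_const,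
          intervalIntegral.integral_const, smul_eq_mul, add_sub_cancel_left]
        field_simp
      rw [e]
      exact av_sup hh fun y hy => hhol t ht x y ⟨hy.1.le, hy.2⟩
    rw [hq]
    have hq' : u t (x + h) - u t x = h * ((u t (x + h) - u t x) / h) := by field_simp
    have hpp : u t (x + h) = 2 * ((u t (x + h) + u t x) / 2) - u t x := by ring
    have b6 : |(u t (x + h) + u t x) / 2| ≤ Real.sqrt B := by
      rw [abs_le] at *
      constructor <;> linarith
    have b7 : |(u t (x + h) + u t x) / 2 - av h (u t) x| ≤ 2 * Real.sqrt (h * B) := by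
      rw [abs_le] at *
      constructor <;> linarith
    rw [hq'] at b4
    generalize (u t (x + h) - u t x) / h = q at *
    generalize (u t (x + h) + u t x) / 2 = p at *
    generalize av h (u t) x = U at *
    generalize Real.sqrt B = S at *
    have hη3 : (h * q) ^ 2 ≤ h * B := by
      rw [← hη2, ← sq_abs (h * q)]
      exact pow_le_pow_left₀ (abs_nonneg _) b4 2
    generalize Real.sqrt (h * B) = η at *
    have e : 1 / 3 * (p ^ 2 - U ^ 2) * (U * q) - h ^ 2 / 12 * q ^ 3 * U =
        (1 / 3 * ((p - U) * (p + U)) - 1 / 12 * (h * q) ^ 2) * (U * q) := by ring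
    rw [e, abs_mul]
    have g1 : |U * q| ≤ U ^ 2 + q ^ 2 :=
      abs_le.2 ⟨by nlinarith [sq_nonneg (U + q), sq_nonneg U, sq_nonneg q], by nlinarith [sq_nonneg (U - q), sq_nonneg U, sq_nonneg q]⟩
    have g2 : |(p - U) * (p + U)| ≤ (2 * η) * (2 * S) := by
      rw [abs_mul]
      refine mul_le_mul b7 ((abs_add_le _ _).trans (by linarith)) (abs_nonneg _) (by positivity)
    have g3 : |1 / 3 * ((p - U) * (p + U)) - 1 / 12 * (h * q) ^ 2| ≤ 4 / 3 * (η * S) + h * B / 12 := by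
      have := sq_nonneg (h * q)
      rw [abs_le] at g2 ⊢
      constructor <;> linarith
    exact mul_le_mul g3 g1 (abs_nonneg _) (by positivity)

end Sol

open MeasureTheory
open Filter Topology Set

namespace Sol

variable {u u1 u2 u3 : ℝ → ℝ → ℝ}

lemma energy_lim (hu : Sol u u1 u2 u3) (t : ℝ) :
    Tendsto (fun n : ℕ => ∫ x, (av (1 / ((n : ℝ) + 1)) (u1 t) x ^ 2
      - (u t (x + 1 / ((n : ℝ) + 1)) + u t x) / 2 * av (1 / ((n : ℝ) + 1)) (u t) x ^ 2 / 3)) atTop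
      (𝓝 (∫ x, (u1 t x ^ 2 - u t x * u t x ^ 2 / 3))) := by
  obtain ⟨k0, C0, hC0⟩ := hu.e0 t
  obtain ⟨k1, C1, hC1⟩ := hu.e1 t
  obtain ⟨S, hS0, hS⟩ := (hu.e0 t).bdd
  have hh : ∀ n : ℕ, 0 < 1 / ((n : ℝ) + 1) := fun n => by positivity
  have hh1 : ∀ n : ℕ, 1 / ((n : ℝ) + 1) ≤ 1 := fun n => by
    rw [div_le_one (by positivity)]
    have : (0 : ℝ) ≤ n := Nat.cast_nonneg n
    linarith
  have hn : Tendsto (fun n : ℕ => 1 / ((n : ℝ) + 1)) atTop (𝓝 0) := tendsto_one_div_add_atTop_nhds_zero_nat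
  have hC00 : 0 ≤ C0 := le_trans (by positivity) (hC0 0)
  have hC10 : 0 ≤ C1 := le_trans (by positivity) (hC1 0)
  refine tendsto_integral_of_dominated_convergence
    (fun x => ((3 * C1) ^ 2 + S * (3 * C0) ^ 2) * (1 + x ^ 2)⁻¹) ?_
    (integrable_inv_one_add_sq.const_mul _) ?_ ?_
  · intro n
    refine Continuous.aestronglyMeasurable ?_
    have h1 := av_cont (h := 1 / ((n : ℝ) + 1)) k0
    have h2 := av_cont (h := 1 / ((n : ℝ) + 1)) k1
    fun_prop
  · intro n
    refine Eventually.of_forall fun x => ?_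
    have a0 := Dec.le_inv (av_bound (hh n) (hh1 n) hC0) x
    have a1 := Dec.le_inv (av_bound (hh n) (hh1 n) hC1) x
    have s1 := hS x
    have s2 := hS (x + 1 / ((n : ℝ) + 1))
    have s3 : |(u t (x + 1 / ((n : ℝ) + 1)) + u t x) / 2| ≤ S := by
      rw [abs_le] at *
      constructor <;> linarith
    generalize (u t (x + 1 / ((n : ℝ) + 1)) + u t x) / 2 = p at *
    generalize av (1 / ((n : ℝ) + 1)) (u t) x = U at *
    generalize av (1 / ((n : ℝ) + 1)) (u1 t) x = q at *
    have hw0 : 0 ≤ (1 + x ^ 2)⁻¹ := by positivity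
    have hw1 : (1 + x ^ 2)⁻¹ ≤ 1 := inv_le_one_of_one_le₀ (by nlinarith [sq_nonneg x])
    generalize (1 + x ^ 2)⁻¹ = w at *
    have hw2 : w ^ 2 ≤ w := by rw [pow_two]; exact mul_le_of_le_one_left hw0 hw1
    have f0 : U ^ 2 ≤ (3 * C0) ^ 2 * w := by
      rw [← sq_abs]
      refine (pow_le_pow_left₀ (abs_nonneg _) a0 2).trans ?_
      rw [mul_pow]
      exact mul_le_mul_of_nonneg_left hw2 (by positivity)
    have f1 : q ^ 2 ≤ (3 * C1) ^ 2 * w := by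
      rw [← sq_abs]
      refine (pow_le_pow_left₀ (abs_nonneg _) a1 2).trans ?_
      rw [mul_pow]
      exact mul_le_mul_of_nonneg_left hw2 (by positivity)
    have f2 : |p * U ^ 2 / 3| ≤ S * ((3 * C0) ^ 2 * w) := by
      rw [abs_div, abs_mul, abs_of_nonneg (sq_nonneg U), abs_of_pos (by norm_num : (0:ℝ) < 3)]
      have := mul_le_mul s3 f0 (sq_nonneg U) hS0
      have h0 : 0 ≤ |p| * U ^ 2 := by positivity
      linarith
    rw [Real.norm_eq_abs]
    refine (abs_sub _ _).trans ?_
    rw [abs_of_nonneg (sq_nonneg q)]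
    linarith
  · refine Eventually.of_forall fun x => ?_
    have hp : Tendsto (fun n : ℕ => (u t (x + 1 / ((n : ℝ) + 1)) + u t x) / 2) atTop (𝓝 (u t x)) := by
      have h1 : Tendsto (fun n : ℕ => u t (x + 1 / ((n : ℝ) + 1))) atTop (𝓝 (u t (x + 0))) :=
        (k0.tendsto _).comp (hn.const_add x)
      rw [add_zero] at h1
      have := (h1.add_const (u t x)).div_const 2
      simpa using this
    exact ((av_tendsto k1 x).pow 2).sub ((hp.mul ((av_tendsto k0 x).pow 2)).div_const 3)

lemma energy_loc (hu : Sol u u1 u2 u3) {a b B : ℝ} (hab : a ≤ b)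
    (hB : ∀ t ∈ Icc a b, ∫ x, (u t x ^ 2 + u1 t x ^ 2) ≤ B) :
    (∫ x, u1 b x ^ 2) - 1 / 3 * (∫ x, u b x ^ 3) = (∫ x, u1 a x ^ 2) - 1 / 3 * ∫ x, u a x ^ 3 := by
  have e : ∀ t, (∫ x, (u1 t x ^ 2 - u t x * u t x ^ 2 / 3)) = (∫ x, u1 t x ^ 2) - 1 / 3 * ∫ x, u t x ^ 3 := by
    intro t
    rw [← integral_const_mul, ← integral_sub (hu.e1 t).sq.integrable ((hu.e0 t).cube.const_mul _).integrable]
    congr 1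
    funext x
    ring
  have hn : Tendsto (fun n : ℕ => 1 / ((n : ℝ) + 1)) atTop (𝓝 0) := tendsto_one_div_add_atTop_nhds_zero_nat
  have hl := ((hu.energy_lim b).sub (hu.energy_lim a)).abs
  have hr : Tendsto (fun n : ℕ => ((4 / 3 * (Real.sqrt (1 / ((n : ℝ) + 1) * B) * Real.sqrt B) + 1 / ((n : ℝ) + 1) * B / 12) * B) * (b - a))
      atTop (𝓝 (((4 / 3 * (Real.sqrt (0 * B) * Real.sqrt B) + 0 * B / 12) * B) * (b - a))) := by
    have h1 := hn.mul_const B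
    have h2 := (Real.continuous_sqrt.tendsto _).comp h1
    exact (((((h2.mul_const (Real.sqrt B)).const_mul (4 / 3)).add (h1.div_const 12)).mul_const B).mul_const _)
  have := le_of_tendsto_of_tendsto' hl hr fun n => by
    refine hu.energy_step hab (by positivity) ?_ hB
    rw [div_le_one (by positivity)]
    have : (0 : ℝ) ≤ n := Nat.cast_nonneg n
    linarith
  simp only [zero_mul, Real.sqrt_zero, zero_div, mul_zero, add_zero] at this
  rw [← e, ← e]
  exact sub_eq_zero.1 (abs_eq_zero.1 (le_antisymm this (abs_nonneg _)))

lemma apriori_aux (hu : Sol u u1 u2 u3) {s t n : ℝ}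
    (hM : ∫ x, u t x ^ 2 = ∫ x, u s x ^ 2)
    (hT : (∫ x, u1 t x ^ 2) - 1 / 3 * (∫ x, u t x ^ 3) = (∫ x, u1 s x ^ 2) - 1 / 3 * ∫ x, u s x ^ 3)
    (hn : ∫ x, (u s x ^ 2 + u1 s x ^ 2) ≤ n) :
    ∫ x, (u t x ^ 2 + u1 t x ^ 2) ≤ 6 * n + 3 * n ^ 2 := by
  have c1 := cube_bound (hu.d0 t) (hu.e0 t) (hu.e1 t)
  have c2 := cube_bound (hu.d0 s) (hu.e0 s) (hu.e1 s)
  rw [integral_add (hu.e0 _).sq.integrable (hu.e1 _).sq.integrable] at hn ⊢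
  have p1 : 0 ≤ ∫ x, u s x ^ 2 := integral_nonneg fun x => by positivity
  have p2 : 0 ≤ ∫ x, u1 s x ^ 2 := integral_nonneg fun x => by positivity
  have p3 : 0 ≤ ∫ x, u1 t x ^ 2 := integral_nonneg fun x => by positivity
  rw [hM] at c1 ⊢
  generalize (∫ x, u s x ^ 2) = M at *
  generalize (∫ x, u1 s x ^ 2) = K at *
  generalize (∫ x, u1 t x ^ 2) = K' at *
  generalize (∫ x, u s x ^ 3) = w at *
  generalize (∫ x, u t x ^ 3) = w' at *
  obtain ⟨a, ha⟩ : ∃ a, a = Real.sqrt (M + K) := ⟨_, rfl⟩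
  obtain ⟨b, hb⟩ : ∃ b, b = Real.sqrt (M + K') := ⟨_, rfl⟩
  rw [← ha] at c2
  rw [← hb] at c1
  have ha2 : a ^ 2 = M + K := by rw [ha]; exact Real.sq_sqrt (by linarith)
  have hb2 : b ^ 2 = M + K' := by rw [hb]; exact Real.sq_sqrt (by linarith)
  have ha0 : 0 ≤ a := ha ▸ Real.sqrt_nonneg _
  have hb0 : 0 ≤ b := hb ▸ Real.sqrt_nonneg _
  rw [abs_le] at c1 c2
  have hMn : M ≤ n := by linarith
  have i1 : a * M ≤ (a ^ 2 + M ^ 2) / 2 := by nlinarith [sq_nonneg (a - M)]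
  have i2 : 1 / 3 * (b * M) ≤ b ^ 2 / 2 + M ^ 2 / 18 := by nlinarith [sq_nonneg (b - M / 3)]
  have i3 : M ^ 2 ≤ n ^ 2 := pow_le_pow_left₀ p1 hMn 2
  linarith

lemma apriori (hu : Sol u u1 u2 u3) {a b B n : ℝ}
    (hB : ∀ t ∈ uIcc a b, ∫ x, (u t x ^ 2 + u1 t x ^ 2) ≤ B)
    (hn : ∫ x, (u a x ^ 2 + u1 a x ^ 2) ≤ n) :
    ∫ x, (u b x ^ 2 + u1 b x ^ 2) ≤ 6 * n + 3 * n ^ 2 := by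
  rcases le_total a b with h | h
  · rw [uIcc_of_le h] at hB
    exact hu.apriori_aux (hu.mass_loc h hB) (hu.energy_loc h hB) hn
  · rw [uIcc_of_ge h] at hB
    exact hu.apriori_aux (hu.mass_loc h hB).symm (hu.energy_loc h hB).symm hn

end Sol

open MeasureTheory
open Filter Topology Set

lemma baire_bound {N : ℝ → ℝ} {G : ℝ → ℝ} (cl : ∀ n, IsClosed {t | N t ≤ n})
    (ap : ∀ a b B n, (∀ t ∈ uIcc a b, N t ≤ B) → N a ≤ n → N b ≤ G n) (a b : ℝ) :
    ∃ B, ∀ t ∈ uIcc a b, N t ≤ B := by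
  obtain ⟨LB, hLB⟩ : ∃ LB : ℝ → Prop, LB = fun t => ∃ B, ∀ᶠ s in 𝓝 t, N s ≤ B := ⟨_, rfl⟩
  have cpt : ∀ a b, (∀ t ∈ uIcc a b, LB t) → ∃ B, ∀ t ∈ uIcc a b, N t ≤ B := by
    intro a b hab
    refine isCompact_uIcc.induction_on (p := fun s => ∃ B, ∀ t ∈ s, N t ≤ B) ⟨0, by simp⟩ ?_ ?_ ?_
    · rintro s t hst ⟨B, hB⟩
      exact ⟨B, fun x hx => hB x (hst hx)⟩
    · rintro s t ⟨B, hB⟩ ⟨B', hB'⟩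
      refine ⟨max B B', fun x hx => ?_⟩
      rcases hx with hx | hx
      · exact (hB x hx).trans (le_max_left _ _)
      · exact (hB' x hx).trans (le_max_right _ _)
    · intro x hx
      have := hab x hx
      rw [hLB] at this
      obtain ⟨B, hB⟩ := this
      exact ⟨_, mem_nhdsWithin_of_mem_nhds hB, B, fun t ht => ht⟩
  refine cpt a b fun t0 _ => ?_
  have gap : ∀ a t n, (∀ s ∈ uIcc a t, s ≠ a → LB s) → N a ≤ n → N t ≤ G n := by
    intro a t n hs hn
    refine ap a t (max (N a) (G (N t))) n (fun s hst => ?_) hn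
    by_cases hsa : s = a
    · rw [hsa]; exact le_max_left _ _
    refine le_trans ?_ (le_max_right _ _)
    obtain ⟨B, hB⟩ := cpt t s (fun r hr => by
      refine hs r ?_ ?_
      · rw [mem_uIcc] at *; grind
      · rintro rfl
        rw [mem_uIcc] at *; grind)
    exact ap t s B _ hB le_rfl
  by_contra hF0
  have hFc : IsClosed {t | ¬ LB t} := by
    rw [← isOpen_compl_iff]
    have : {t | ¬ LB t}ᶜ = {t | LB t} := by ext; simp
    rw [this, isOpen_iff_mem_nhds]
    intro t ht
    rw [hLB] at ht
    obtain ⟨B, hB⟩ := ht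
    filter_upwards [eventually_eventually_nhds.2 hB] with s hs
    rw [hLB]
    exact ⟨B, hs⟩
  have : CompleteSpace {t | ¬ LB t} := hFc.completeSpace_coe
  have : Nonempty {t | ¬ LB t} := ⟨⟨t0, hF0⟩⟩
  obtain ⟨n, ⟨t1, ht1⟩⟩ := nonempty_interior_of_iUnion_of_closed
    (f := fun n : ℕ => {t : {t | ¬ LB t} | N t ≤ n})
    (fun n => (cl n).preimage continuous_subtype_val) (by
      ext t
      simp only [mem_iUnion, mem_ofPred_eq, mem_univ, iff_true]
      exact exists_nat_ge _)
  rw [mem_interior_iff_mem_nhds, Metric.mem_nhds_iff] at ht1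
  obtain ⟨ε, hε, hball⟩ := ht1
  have hb : ∀ t, ¬ LB t → |t - t1| < ε → N t ≤ n := fun t ht htt =>
    hball (show (⟨t, ht⟩ : {t | ¬ LB t}) ∈ Metric.ball t1 ε from htt)
  refine t1.2 ?_
  refine (congrFun hLB (t1 : ℝ)).mpr ⟨max n (G n), ?_⟩
  filter_upwards [Metric.ball_mem_nhds (t1 : ℝ) hε] with t ht
  rw [Metric.mem_ball, Real.dist_eq] at ht
  by_cases hLt : LB t
  · refine le_trans ?_ (le_max_right _ _)
    have hcpt : IsCompact (uIcc (t1 : ℝ) t ∩ {t | ¬ LB t}) := isCompact_uIcc.inter_right hFc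
    obtain ⟨a, ⟨ha1, ha2⟩, hmin⟩ := hcpt.exists_isMinOn ⟨t1, left_mem_uIcc, t1.2⟩
      (f := fun s => |s - t|) (by fun_prop)
    refine gap a t n (fun s hs hsa => ?_) (hb a ha2 ?_)
    · by_contra hLs
      have h1 : |a - t| ≤ |s - t| := hmin ⟨by rw [mem_uIcc] at *; grind, hLs⟩
      rw [mem_uIcc] at hs
      grind
    · rw [mem_uIcc] at ha1
      grind
  · exact (hb t hLt ht).trans (le_max_left _ _)

namespace Sol

variable {u u1 u2 u3 : ℝ → ℝ → ℝ}

lemma closed_N (hu : Sol u u1 u2 u3) (n : ℝ) : IsClosed {t | ∫ x, (u t x ^ 2 + u1 t x ^ 2) ≤ n} := by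
  have e : {t | ∫ x, (u t x ^ 2 + u1 t x ^ 2) ≤ n} =
      ⋂ k : ℕ, {t | ∫ x in (-(k : ℝ))..(k : ℝ), (u t x ^ 2 + u1 t x ^ 2) ≤ n} := by
    ext t
    simp only [mem_ofPred_eq, mem_iInter]
    have hd := (hu.e0 t).sq.add (hu.e1 t).sq
    constructor
    · intro h k
      refine (interval_le_full hd (fun x => by positivity) ?_).trans h
      have : (0 : ℝ) ≤ k := Nat.cast_nonneg k
      linarith
    · intro h
      have hk : Tendsto (fun k : ℕ => (k : ℝ)) atTop atTop := tendsto_natCast_atTop_atTop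
      have := intervalIntegral_tendsto_integral hd.integrable (tendsto_neg_atTop_atBot.comp hk) hk
      exact le_of_tendsto' this h
  rw [e]
  refine isClosed_iInter fun k => isClosed_le ?_ continuous_const
  have c0 := hu.c0
  have c1 := hu.c1
  refine intervalIntegral.continuous_parametric_intervalIntegral_of_continuous'
    (f := fun t x => (u t x ^ 2 + u1 t x ^ 2)) ?_ _ _
  simp only [Function.uncurry_def] at *
  fun_prop

lemma bounded (hu : Sol u u1 u2 u3) (a b : ℝ) :
    ∃ B, ∀ t ∈ uIcc a b, ∫ x, (u t x ^ 2 + u1 t x ^ 2) ≤ B :=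
  baire_bound (G := fun n => 6 * n + 3 * n ^ 2) hu.closed_N (fun _ _ _ _ h1 h2 => hu.apriori h1 h2) a b

lemma mass (hu : Sol u u1 u2 u3) (t : ℝ) : ∫ x, u t x ^ 2 = ∫ x, u 0 x ^ 2 := by
  obtain ⟨B, hB⟩ := hu.bounded 0 t
  rcases le_total 0 t with h | h
  · rw [uIcc_of_le h] at hB
    exact hu.mass_loc h hB
  · rw [uIcc_of_ge h] at hB
    exact (hu.mass_loc h hB).symm

lemma energy (hu : Sol u u1 u2 u3) (t : ℝ) :
    (∫ x, u1 t x ^ 2) - 1 / 3 * (∫ x, u t x ^ 3) = (∫ x, u1 0 x ^ 2) - 1 / 3 * ∫ x, u 0 x ^ 3 := by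
  obtain ⟨B, hB⟩ := hu.bounded 0 t
  rcases le_total 0 t with h | h
  · rw [uIcc_of_le h] at hB
    exact hu.energy_loc h hB
  · rw [uIcc_of_ge h] at hB
    exact (hu.energy_loc h hB).symm

/-- Global bound on the `H¹` norm. -/
lemma global (hu : Sol u u1 u2 u3) : ∃ B, ∀ t, ∫ x, (u t x ^ 2 + u1 t x ^ 2) ≤ B :=
  ⟨_, fun t => hu.apriori_aux (hu.mass t) (hu.energy t) le_rfl⟩

end Sol

open MeasureTheory
open Filter Topology Set

lemma Dec.shift' {f : ℝ → ℝ} (hf : Dec f) (a : ℝ) : Dec (fun x => f (x - a)) := by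
  simpa [sub_eq_add_neg] using hf.shift (-a)

lemma deriv_shift {f g : ℝ → ℝ} (h : ∀ x, HasDerivAt f (g x) x) (a x : ℝ) :
    HasDerivAt (fun x => f (x - a)) (g (x - a)) x := (h (x - a)).comp_sub_const x a

lemma Q1_le3 (x : ℝ) : |Q1 x| ≤ 3 := (Q1_abs x).trans (Q_le x)

lemma Qabs_le3 (x : ℝ) : |Q x| ≤ 3 := by rw [abs_of_pos (Q_pos x)]; exact Q_le x

namespace Sol

variable {u u1 u2 u3 : ℝ → ℝ → ℝ}

set_option maxHeartbeats 1000000 in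
lemma lip_aux (hu : Sol u u1 u2 u3) : ∃ K, 0 ≤ K ∧ ∀ c a b, a ≤ b →
    |(∫ x, u b x * Q (x - c)) - ∫ x, u a x * Q (x - c)| ≤ K * (b - a) := by
  obtain ⟨B, hB⟩ := hu.global
  have hB0 : 0 ≤ B := le_trans (integral_nonneg fun x => by positivity) (hB 0)
  obtain ⟨W, hW⟩ : ∃ W : ℝ → ℝ, W = fun x => Q x ^ 2 + Q1 x ^ 2 + (Q x - Q x ^ 2 / 2) ^ 2 + (Q1 x - Q x * Q1 x) ^ 2 := ⟨_, rfl⟩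
  have hWd : Dec W := by
    rw [hW]
    exact ((Q_dec.sq.add Q1_dec.sq).add Q2_dec.sq).add Q3_dec.sq
  have hW0 : 0 ≤ ∫ x, W x := integral_nonneg fun x => by rw [hW]; simp only [Pi.zero_apply]; positivity
  refine ⟨2 * B + ∫ x, W x, by positivity, fun c a b hab => ?_⟩
  have c0 := hu.c0
  have c1 := hu.c1
  have c3 := hu.c3
  have k0 := fun t => cont_slice hu.c0 t
  have k1 := fun t => cont_slice hu.c1 t
  have k2 := fun t => cont_slice hu.c2 t
  have k3 := fun t => cont_slice hu.c3 t
  have P := Q_dec.shift' c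
  have P1 := Q1_dec.shift' c
  have P2 := Q2_dec.shift' c
  have P3 := Q3_dec.shift' c
  have p0 := fun x => deriv_shift Q_deriv c x
  have p1 := fun x => deriv_shift Q1_deriv c x
  have p2 := fun x => deriv_shift Q2_deriv c x
  have hQc := Q_cont
  have hQ1c := Q1_cont
  have main : ∀ t, ∀ f : ℝ → ℝ, Dec f → (∀ x, |f x| ≤ 2 * (u t x ^ 2 + u1 t x ^ 2) + W (x - c)) →
      ∫ x, |f x| ≤ 2 * B + ∫ x, W x := by
    intro t f hf hle
    have dE := (hu.e0 t).sq.add (hu.e1 t).sq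
    refine (integral_mono hf.abs.integrable ((dE.const_mul 2).add (hWd.shift' c)).integrable hle).trans ?_
    rw [integral_add (dE.const_mul 2).integrable (hWd.shift' c).integrable, integral_const_mul,
      integral_sub_right_eq_self W c]
    have := hB t
    linarith
  have dj1 : ∀ t, Dec (fun x => -1 / 2 * (u t x ^ 2 * Q (x - c)) + 2 * (u1 t x * Q1 (x - c))
      - u t x * (Q (x - c) - Q (x - c) ^ 2 / 2)) := fun t =>
    (((((hu.e0 t).sq.mul P).const_mul _).add (((hu.e1 t).mul P1).const_mul _)).sub ((hu.e0 t).mul P2))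
  have dj2 : ∀ t, Dec (fun x => -1 * (u1 t x * Q (x - c))) := fun t => ((hu.e1 t).mul P).const_mul _
  have ds : ∀ t, Dec (fun x => 1 / 2 * (u t x ^ 2 * Q1 (x - c)) + u t x * (Q1 (x - c) - Q (x - c) * Q1 (x - c))) :=
    fun t => (((hu.e0 t).sq.mul P1).const_mul _).add ((hu.e0 t).mul P3)
  refine balance (C := 2 * B + ∫ x, W x) hab
    (ρ := fun t x => u t x * Q (x - c))
    (ρt := fun t x => (-(u t x * u1 t x) - u3 t x) * Q (x - c))
    (j1 := fun t x => -1 / 2 * (u t x ^ 2 * Q (x - c)) + 2 * (u1 t x * Q1 (x - c))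
      - u t x * (Q (x - c) - Q (x - c) ^ 2 / 2))
    (j1x := fun t x => -1 / 2 * (2 * u t x * u1 t x * Q (x - c) + u t x ^ 2 * Q1 (x - c))
      + 2 * (u2 t x * Q1 (x - c) + u1 t x * (Q (x - c) - Q (x - c) ^ 2 / 2))
      - (u1 t x * (Q (x - c) - Q (x - c) ^ 2 / 2) + u t x * (Q1 (x - c) - Q (x - c) * Q1 (x - c))))
    (j2 := fun t x => -1 * (u1 t x * Q (x - c)))
    (j2x := fun t x => -1 * (u2 t x * Q (x - c) + u1 t x * Q1 (x - c)))
    (j2xx := fun t x => -1 * (u3 t x * Q (x - c) + 2 * (u2 t x * Q1 (x - c))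
      + u1 t x * (Q (x - c) - Q (x - c) ^ 2 / 2)))
    (s := fun t x => 1 / 2 * (u t x ^ 2 * Q1 (x - c)) + u t x * (Q1 (x - c) - Q (x - c) * Q1 (x - c)))
    (by simp only [Function.uncurry_def] at *; fun_prop)
    (by simp only [Function.uncurry_def] at *; fun_prop)
    (fun t x => (hu.dt t x).mul_const _)
    (fun t x => by ring)
    (fun t x => ((((((hu.d0 t x).fun_pow 2).fun_mul (p0 x)).const_mul (-1 / 2)).fun_add
      (((hu.d1 t x).fun_mul (p1 x)).const_mul 2)).fun_sub ((hu.d0 t x).fun_mul (p2 x))).congr_deriv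
      (by norm_num))
    (fun t x => ((hu.d1 t x).fun_mul (p0 x)).const_mul (-1))
    (fun t x => ((((hu.d2 t x).fun_mul (p0 x)).fun_add ((hu.d1 t x).fun_mul (p1 x))).const_mul (-1)).congr_deriv
      (by ring))
    (fun t => by fun_prop) (fun t => by fun_prop) dj1 dj2 ds (fun t => (hu.e0 t).mul P)
    (fun t _ => main t _ (dj1 t) fun x => ?_) (fun t _ => main t _ (dj2 t) fun x => ?_)
    (fun t _ => main t _ (ds t) fun x => ?_)
  all_goals
    rw [hW]
    have q0 := Qabs_le3 (x - c)
    have q1 := Q1_le3 (x - c)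
    simp only
    generalize Q (x - c) = q at *
    generalize Q1 (x - c) = r at *
    generalize u t x = v at *
    generalize u1 t x = w at *
  · generalize q - q ^ 2 / 2 = z at *
    have h1 : |v ^ 2 * q| ≤ v ^ 2 * 3 := by
      rw [abs_mul, abs_of_nonneg (sq_nonneg v)]; exact mul_le_mul_of_nonneg_left q0 (sq_nonneg _)
    have h2 : 2 * |w * r| ≤ w ^ 2 + r ^ 2 := by
      rw [abs_mul]; nlinarith [sq_nonneg (|w| - |r|), sq_abs w, sq_abs r]
    have h3 : 2 * |v * z| ≤ v ^ 2 + z ^ 2 := by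
      rw [abs_mul]; nlinarith [sq_nonneg (|v| - |z|), sq_abs v, sq_abs z]
    have h4 := le_abs_self (v ^ 2 * q)
    have h5 := neg_abs_le (v ^ 2 * q)
    have h6 := le_abs_self (w * r)
    have h7 := neg_abs_le (w * r)
    have h8 := le_abs_self (v * z)
    have h9 := neg_abs_le (v * z)
    have := sq_nonneg w
    have := sq_nonneg r
    have := sq_nonneg z
    have := sq_nonneg v
    have := sq_nonneg q
    have := sq_nonneg (r - q * r)
    rw [abs_le]
    constructor <;> linarith
  · have h2 : 2 * |w * q| ≤ w ^ 2 + q ^ 2 := by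
      rw [abs_mul]; nlinarith [sq_nonneg (|w| - |q|), sq_abs w, sq_abs q]
    have h6 := le_abs_self (w * q)
    have h7 := neg_abs_le (w * q)
    have := sq_nonneg w
    have := sq_nonneg r
    have := sq_nonneg v
    have := sq_nonneg q
    have := sq_nonneg (r - q * r)
    have := sq_nonneg (q - q ^ 2 / 2)
    rw [abs_le]
    constructor <;> linarith
  · have hz := sq_nonneg (q - q ^ 2 / 2)
    generalize r - q * r = z at *
    have h1 : |v ^ 2 * r| ≤ v ^ 2 * 3 := by
      rw [abs_mul, abs_of_nonneg (sq_nonneg v)]; exact mul_le_mul_of_nonneg_left q1 (sq_nonneg _)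
    have h3 : 2 * |v * z| ≤ v ^ 2 + z ^ 2 := by
      rw [abs_mul]; nlinarith [sq_nonneg (|v| - |z|), sq_abs v, sq_abs z]
    have h4 := le_abs_self (v ^ 2 * r)
    have h5 := neg_abs_le (v ^ 2 * r)
    have h8 := le_abs_self (v * z)
    have h9 := neg_abs_le (v * z)
    have := sq_nonneg w
    have := sq_nonneg r
    have := sq_nonneg z
    have := sq_nonneg v
    have := sq_nonneg q
    rw [abs_le]
    constructor <;> linarith

lemma dist_eq (hu : Sol u u1 u2 u3) (t c : ℝ) : ∫ x, (u t x - Q (x - c)) ^ 2 =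
    (∫ x, u 0 x ^ 2) + (∫ x, Q x ^ 2) - 2 * ∫ x, u t x * Q (x - c) := by
  have P := Q_dec.shift' c
  have e : ∀ x, (u t x - Q (x - c)) ^ 2 = (u t x ^ 2 + Q (x - c) ^ 2) - 2 * (u t x * Q (x - c)) := fun x => by ring
  simp_rw [e]
  rw [integral_sub ((hu.e0 t).sq.add P.sq).integrable (((hu.e0 t).mul P).const_mul 2).integrable,
    integral_add (hu.e0 t).sq.integrable P.sq.integrable, integral_const_mul, hu.mass t,
    integral_sub_right_eq_self (fun x => Q x ^ 2) c]

lemma lip (hu : Sol u u1 u2 u3) : ∃ K, 0 ≤ K ∧ ∀ c s t,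
    ∫ x, (u t x - Q (x - c)) ^ 2 ≤ (∫ x, (u s x - Q (x - c)) ^ 2) + K * |t - s| := by
  obtain ⟨K, hK, h⟩ := hu.lip_aux
  refine ⟨2 * K, by positivity, fun c s t => ?_⟩
  rw [hu.dist_eq, hu.dist_eq]
  rcases le_total s t with hst | hst
  · have := abs_le.1 (h c s t hst)
    rw [abs_of_nonneg (by linarith)]
    linarith
  · have := abs_le.1 (h c t s hst)
    rw [abs_of_nonpos (by linarith)]
    linarith

end Sol

/-- Existence of an optimal translation. -/
lemma modulation {f : ℝ → ℝ} (hf : Dec f) {a0 : ℝ} (h0 : 0 < ∫ x, f x * Q (x - a0)) :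
    ∃ a, (∫ x, f x * Q (x - a0)) ≤ (∫ x, f x * Q (x - a)) ∧ ∫ x, f x * Q1 (x - a) = 0 := by
  have hd : ∀ a, HasDerivAt (fun a => ∫ x, f x * Q (x - a)) (∫ x, f x * (-Q1 (x - a))) a := by
    intro a
    refine (hasDerivAt_integral_of_dominated_loc_of_deriv_le (F := fun a x => f x * Q (x - a))
      (F' := fun a x => f x * (-Q1 (x - a))) (bound := fun x => |f x| * 3)
      (s := univ) univ_mem ?_ ?_ ?_ ?_ ?_ ?_).2
    · exact Eventually.of_forall fun b => (hf.mul (Q_dec.shift' b)).cont.aestronglyMeasurable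
    · exact (hf.mul (Q_dec.shift' a)).integrable
    · exact (hf.mul (Q1_dec.shift' a).neg).cont.aestronglyMeasurable
    · refine Eventually.of_forall fun x b _ => ?_
      rw [Real.norm_eq_abs, abs_mul, abs_neg]
      exact mul_le_mul_of_nonneg_left (Q1_le3 _) (abs_nonneg _)
    · exact (hf.abs.mul_const 3).integrable
    · refine Eventually.of_forall fun x b _ => ?_
      have h1 : HasDerivAt (fun b => x - b) (-1) b := (hasDerivAt_id b).const_sub x
      have h2 := (Q_deriv (x - b)).comp b h1
      refine (h2.const_mul (f x)).congr_deriv (by ring)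
  have hc : Continuous (fun a => ∫ x, f x * Q (x - a)) :=
    continuous_iff_continuousAt.2 fun a => (hd a).continuousAt
  have hlim : ∀ l : Filter ℝ, l.IsCountablyGenerated → (∀ x, Tendsto (fun a => (x - a) ^ 2) l atTop) →
      Tendsto (fun a => ∫ x, f x * Q (x - a)) l (𝓝 0) := by
    intro l hl hx
    have : Tendsto (fun a => ∫ x, f x * Q (x - a)) l (𝓝 (∫ x : ℝ, (0 : ℝ))) := by
      refine tendsto_integral_filter_of_dominated_convergence (fun x => |f x| * 3) ?_ ?_
        (hf.abs.mul_const 3).integrable ?_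
      · exact Eventually.of_forall fun b => (hf.mul (Q_dec.shift' b)).cont.aestronglyMeasurable
      · refine Eventually.of_forall fun b => Eventually.of_forall fun x => ?_
        rw [Real.norm_eq_abs, abs_mul]
        exact mul_le_mul_of_nonneg_left (Qabs_le3 _) (abs_nonneg _)
      · refine Eventually.of_forall fun x => ?_
        obtain ⟨_, C, hC⟩ := Q_dec
        have h1 : Tendsto (fun a => 1 + (x - a) ^ 2) l atTop := tendsto_atTop_add_const_left _ _ (hx x)
        have h2 : Tendsto (fun a => C * (1 + (x - a) ^ 2)⁻¹) l (𝓝 0) := by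
          simpa using (tendsto_inv_atTop_zero.comp h1).const_mul C
        have h3 : Tendsto (fun a => Q (x - a)) l (𝓝 0) :=
          squeeze_zero_norm (fun a => Dec.le_inv hC (x - a)) h2
        simpa using h3.const_mul (f x)
    simpa using this
  have htop := hlim atTop inferInstance fun x => by
    refine Dec.sq_atBot.comp ?_
    have h : Tendsto (fun a : ℝ => x + -a) atTop atBot :=
      tendsto_atBot_add_const_left _ x tendsto_neg_atTop_atBot
    exact h.congr fun a => (sub_eq_add_neg x a).symm
  have hbot := hlim atBot inferInstance fun x => by
    refine Dec.sq_atTop.comp ?_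
    have h : Tendsto (fun a : ℝ => x + -a) atBot atTop :=
      tendsto_atTop_add_const_left _ x tendsto_neg_atBot_atTop
    exact h.congr fun a => (sub_eq_add_neg x a).symm
  obtain ⟨a, ha⟩ := hc.exists_forall_ge' a0 (by
    rw [cocompact_eq_atBot_atTop, eventually_sup]
    exact ⟨(hbot.eventually_le_const h0), (htop.eventually_le_const h0)⟩)
  refine ⟨a, ha a0, ?_⟩
  have hz : ∫ x, f x * (-Q1 (x - a)) = 0 :=
    IsLocalMax.hasDerivAt_eq_zero (Eventually.of_forall ha) (hd a)
  simp only [mul_neg, integral_neg, neg_eq_zero] at hz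
  exact hz

open MeasureTheory
open Filter Topology Set

lemma mass_expand {w : ℝ → ℝ} (hw : Dec w) :
    2 * (∫ x, Q x * (w x - Q x)) + ∫ x, (w x - Q x) ^ 2 = (∫ x, w x ^ 2) - ∫ x, Q x ^ 2 := by
  have hv := hw.sub Q_dec
  rw [← integral_const_mul, ← integral_add ((Q_dec.mul hv).const_mul 2).integrable hv.sq.integrable,
    ← integral_sub hw.sq.integrable Q_dec.sq.integrable]
  congr 1
  ext x
  ring

lemma ham_expand {w w1 : ℝ → ℝ} (hw : Dec w) (hw1 : Dec w1) (hd : ∀ x, HasDerivAt w (w1 x) x) :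
    (∫ x, ((w1 x - Q1 x) ^ 2 + ((w x - Q x) ^ 2 - Q x * (w x - Q x) ^ 2)))
      - 1 / 3 * ∫ x, (w x - Q x) ^ 3 =
    (((∫ x, w1 x ^ 2) - 1 / 3 * ∫ x, w x ^ 3) + ∫ x, w x ^ 2)
      - (((∫ x, Q1 x ^ 2) - 1 / 3 * ∫ x, Q x ^ 3) + ∫ x, Q x ^ 2) := by
  have hv := hw.sub Q_dec
  have hv1 := hw1.sub Q1_dec
  have hl : ∫ x, ((Q x - Q x ^ 2 / 2) * (w x - Q x) + Q1 x * (w1 x - Q1 x)) = 0 :=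
    Dec.integral_deriv (Q1_dec.mul hv) ((Q2_dec.mul hv).add (Q1_dec.mul hv1))
      fun x => (Q1_deriv x).fun_mul ((hd x).fun_sub (Q_deriv x))
  have e1 : (∫ x, ((w1 x - Q1 x) ^ 2 + ((w x - Q x) ^ 2 - Q x * (w x - Q x) ^ 2)))
      - 1 / 3 * ∫ x, (w x - Q x) ^ 3 = ((∫ x, ((w1 x - Q1 x) ^ 2 + ((w x - Q x) ^ 2 - Q x * (w x - Q x) ^ 2)))
      - 1 / 3 * ∫ x, (w x - Q x) ^ 3) +
      2 * ∫ x, ((Q x - Q x ^ 2 / 2) * (w x - Q x) + Q1 x * (w1 x - Q1 x)) := by rw [hl]; ring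
  rw [e1]
  have dA := hv1.sq.add (hv.sq.sub (Q_dec.mul hv.sq))
  have dL := (Q2_dec.mul hv).add (Q1_dec.mul hv1)
  rw [← integral_const_mul, ← integral_const_mul, ← integral_const_mul, ← integral_const_mul,
    ← integral_sub dA.integrable (hv.cube.const_mul _).integrable,
    ← integral_add (dA.sub (hv.cube.const_mul _)).integrable (dL.const_mul 2).integrable,
    ← integral_sub hw1.sq.integrable (hw.cube.const_mul _).integrable,
    ← integral_sub Q1_dec.sq.integrable (Q_dec.cube.const_mul _).integrable,
    ← integral_add (hw1.sq.sub (hw.cube.const_mul _)).integrable hw.sq.integrable,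
    ← integral_add (Q1_dec.sq.sub (Q_dec.cube.const_mul _)).integrable Q_dec.sq.integrable,
    ← integral_sub ((hw1.sq.sub (hw.cube.const_mul _)).add hw.sq).integrable
      ((Q1_dec.sq.sub (Q_dec.cube.const_mul _)).add Q_dec.sq).integrable]
  congr 1
  ext x
  ring

lemma QQ1_zero : ∫ x, Q x * Q1 x = 0 :=
  Dec.integral_deriv (Q_dec.sq.div_const 2) (Q_dec.mul Q1_dec)
    fun x => (((Q_deriv x).fun_pow 2).div_const 2).congr_deriv (by norm_num; ring)

/-- Initial closeness gives closeness of the invariants. -/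
lemma init_bound {w w1 : ℝ → ℝ} (hw : Dec w) (hw1 : Dec w1) (hd : ∀ x, HasDerivAt w (w1 x) x)
    {δ D : ℝ} (h0 : 0 < δ) (h1 : δ ≤ 1) (hD : (2 * Real.sqrt (∫ x, Q x ^ 2) + 6) * δ ≤ D)
    (h : (∫ x, (w x - Q x) ^ 2) + (∫ x, (w1 x - Q1 x) ^ 2) ≤ δ ^ 2) :
    |2 * (∫ x, Q x * (w x - Q x)) + ∫ x, (w x - Q x) ^ 2| ≤ D ∧
    |(∫ x, ((w1 x - Q1 x) ^ 2 + ((w x - Q x) ^ 2 - Q x * (w x - Q x) ^ 2)))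
      - 1 / 3 * ∫ x, (w x - Q x) ^ 3| ≤ D := by
  have hv := hw.sub Q_dec
  have hv1 := hw1.sub Q1_dec
  have hcs := Q_dec.cauchy_schwarz hv
  have hcb := cube_bound (fun x => (hd x).fun_sub (Q_deriv x)) hv hv1
  have hqb := Qint_bound hv
  have hq0 : 0 ≤ ∫ x, Q x * (w x - Q x) ^ 2 :=
    integral_nonneg fun x => mul_nonneg (Q_pos x).le (sq_nonneg _)
  have hX : 0 ≤ ∫ x, (w x - Q x) ^ 2 := integral_nonneg fun x => sq_nonneg _
  have hY : 0 ≤ ∫ x, (w1 x - Q1 x) ^ 2 := integral_nonneg fun x => sq_nonneg _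
  have hM := Qsq_pos
  rw [integral_add hv1.sq.integrable (hv.sq.sub (Q_dec.mul hv.sq)).integrable,
    integral_sub hv.sq.integrable (Q_dec.mul hv.sq).integrable]
  generalize (∫ x, Q x ^ 2) = M at *
  generalize (∫ x, (w x - Q x) ^ 2) = X at *
  generalize (∫ x, (w1 x - Q1 x) ^ 2) = Y at *
  generalize (∫ x, Q x * (w x - Q x) ^ 2) = Z at *
  generalize (∫ x, Q x * (w x - Q x)) = L at *
  generalize (∫ x, (w x - Q x) ^ 3) = K at *
  have hs : Real.sqrt (X + Y) ≤ 1 := by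
    rw [Real.sqrt_le_iff]
    refine ⟨zero_le_one, ?_⟩
    nlinarith
  have hK : |K| ≤ X := hcb.trans (by nlinarith)
  have hδ : δ ^ 2 ≤ δ := by nlinarith
  have hsq := Real.sq_sqrt hM.le
  have hsn := Real.sqrt_nonneg M
  have hL : |L| ≤ Real.sqrt M * δ := by
    refine abs_le_of_sq_le_sq ?_ (by positivity)
    rw [mul_pow, hsq]
    nlinarith
  rw [abs_le] at hK hL ⊢
  rw [abs_le]
  have : 0 ≤ Real.sqrt M * δ := by positivity
  refine ⟨⟨?_, ?_⟩, ?_, ?_⟩ <;> nlinarith [hK.1, hK.2, hL.1, hL.2]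

namespace Sol

variable {u u1 u2 u3 : ℝ → ℝ → ℝ}

lemma step (hu : Sol u u1 u2 u3) {r C D : ℝ} (hrM : r < ∫ x, Q x ^ 2)
    (hst : ∀ v v1 : ℝ → ℝ, (∀ x, HasDerivAt v (v1 x) x) → Dec v → Dec v1 → (∫ x, v x * Q1 x) = 0 →
      (∫ x, v x ^ 2) ≤ r → |2 * (∫ x, Q x * v x) + ∫ x, v x ^ 2| ≤ D →
      |(∫ x, (v1 x ^ 2 + (v x ^ 2 - Q x * v x ^ 2))) - 1 / 3 * ∫ x, v x ^ 3| ≤ D →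
      (∫ x, v x ^ 2) + (∫ x, v1 x ^ 2) ≤ C * D)
    (hM : |2 * (∫ x, Q x * (u 0 x - Q x)) + ∫ x, (u 0 x - Q x) ^ 2| ≤ D)
    (hH : |(∫ x, ((u1 0 x - Q1 x) ^ 2 + ((u 0 x - Q x) ^ 2 - Q x * (u 0 x - Q x) ^ 2)))
      - 1 / 3 * ∫ x, (u 0 x - Q x) ^ 3| ≤ D)
    {t a0 : ℝ} (h0 : ∫ x, (u t x - Q (x - a0)) ^ 2 ≤ r) :
    ∃ a, (∫ x, (u t x - Q (x - a)) ^ 2) + (∫ x, (u1 t x - Q1 (x - a)) ^ 2) ≤ C * D := by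
  have hM0 : 0 ≤ ∫ x, u 0 x ^ 2 := integral_nonneg fun x => sq_nonneg _
  have hp := hu.dist_eq t a0
  obtain ⟨a, ha, ho⟩ := modulation (hu.e0 t) (a0 := a0) (by linarith)
  refine ⟨a, ?_⟩
  have hq := hu.dist_eq t a
  have hr : ∫ x, (u t x - Q (x - a)) ^ 2 ≤ r := by linarith
  have dw := (hu.e0 t).shift a
  have dw1 := (hu.e1 t).shift a
  have hd : ∀ x, HasDerivAt (fun x => u t (x + a)) (u1 t (x + a)) x := fun x =>
    (hu.d0 t (x + a)).comp_add_const x a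
  have t1 : ∫ x, (u t (x + a) - Q x) ^ 2 = ∫ x, (u t x - Q (x - a)) ^ 2 := by
    rw [← integral_add_right_eq_self (fun x => (u t x - Q (x - a)) ^ 2) a]
    simp
  have t2 : ∫ x, (u1 t (x + a) - Q1 x) ^ 2 = ∫ x, (u1 t x - Q1 (x - a)) ^ 2 := by
    rw [← integral_add_right_eq_self (fun x => (u1 t x - Q1 (x - a)) ^ 2) a]
    simp
  have t3 : ∫ x, u t (x + a) * Q1 x = 0 := by
    rw [← ho, ← integral_add_right_eq_self (fun x => u t x * Q1 (x - a)) a]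
    simp
  rw [← t1, ← t2]
  refine hst (fun x => u t (x + a) - Q x) (fun x => u1 t (x + a) - Q1 x)
    (fun x => (hd x).fun_sub (Q_deriv x)) (dw.sub Q_dec) (dw1.sub Q1_dec) ?_ (t1.le.trans hr) ?_ ?_
  · simp_rw [sub_mul]
    rw [integral_sub (dw.mul Q1_dec).integrable (Q_dec.mul Q1_dec).integrable, t3, QQ1_zero, sub_zero]
  · rw [mass_expand (hu.e0 0)] at hM
    rw [mass_expand dw, integral_add_right_eq_self (fun x => u t x ^ 2) a, hu.mass t]
    exact hM
  · rw [ham_expand (hu.e0 0) (hu.e1 0) (hu.d0 0)] at hH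
    rw [ham_expand dw dw1 hd, integral_add_right_eq_self (fun x => u t x ^ 2) a,
      integral_add_right_eq_self (fun x => u t x ^ 3) a,
      integral_add_right_eq_self (fun x => u1 t x ^ 2) a, hu.mass t, hu.energy t]
    exact hH

end Sol

lemma Sol_stab (ε : ℝ) (hε : 0 < ε) : ∃ δ > 0, ∀ u u1 u2 u3 : ℝ → ℝ → ℝ, Sol u u1 u2 u3 →
    (∫ x, (u 0 x - Q x) ^ 2) + (∫ x, (u1 0 x - Q1 x) ^ 2) ≤ δ ^ 2 →
    ∀ t, ∃ a, (∫ x, (u t x - Q (x - a)) ^ 2) + (∫ x, (u1 t x - Q1 (x - a)) ^ 2) < ε ^ 2 := by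
  obtain ⟨r0, hr0, d0, hd0, C, hC, hst⟩ := static_main
  have hMp := Qsq_pos
  obtain ⟨r, hr, hrr0, hrM⟩ : ∃ r > 0, r ≤ r0 ∧ r < ∫ x, Q x ^ 2 :=
    ⟨min r0 ((∫ x, Q x ^ 2) / 2), lt_min hr0 (by linarith), min_le_left _ _,
      (min_le_right _ _).trans_lt (by linarith)⟩
  obtain ⟨D, hD, hDd, hDr, hDe⟩ : ∃ D > 0, D ≤ d0 ∧ C * D ≤ r / 2 ∧ C * D < ε ^ 2 := by
    refine ⟨min d0 (min (r / (2 * C)) (ε ^ 2 / (2 * C))), by positivity, min_le_left _ _, ?_, ?_⟩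
    · have : min d0 (min (r / (2 * C)) (ε ^ 2 / (2 * C))) ≤ r / (2 * C) :=
        (min_le_right _ _).trans (min_le_left _ _)
      calc _ ≤ C * (r / (2 * C)) := mul_le_mul_of_nonneg_left this hC.le
        _ = r / 2 := by field_simp
    · have : min d0 (min (r / (2 * C)) (ε ^ 2 / (2 * C))) ≤ ε ^ 2 / (2 * C) :=
        (min_le_right _ _).trans (min_le_right _ _)
      calc _ ≤ C * (ε ^ 2 / (2 * C)) := mul_le_mul_of_nonneg_left this hC.le
        _ = ε ^ 2 / 2 := by field_simp
        _ < ε ^ 2 := by have : 0 < ε ^ 2 := by positivity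
                        linarith
  have hS : 0 < 2 * Real.sqrt (∫ x, Q x ^ 2) + 6 := by positivity
  obtain ⟨δ, hδ, hδ1, hδr, hδD⟩ : ∃ δ > 0, δ ≤ 1 ∧ δ ≤ r ∧
      (2 * Real.sqrt (∫ x, Q x ^ 2) + 6) * δ ≤ D := by
    refine ⟨min 1 (min r (D / (2 * Real.sqrt (∫ x, Q x ^ 2) + 6))), by positivity, min_le_left _ _,
      (min_le_right _ _).trans (min_le_left _ _), ?_⟩
    have : min 1 (min r (D / (2 * Real.sqrt (∫ x, Q x ^ 2) + 6))) ≤ D / (2 * Real.sqrt (∫ x, Q x ^ 2) + 6) :=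
      (min_le_right _ _).trans (min_le_right _ _)
    rw [le_div_iff₀ hS] at this
    linarith
  refine ⟨δ, hδ, fun u u1 u2 u3 hu h => ?_⟩
  obtain ⟨hM, hH⟩ := init_bound (hu.e0 0) (hu.e1 0) (hu.d0 0) hδ hδ1 hδD h
  have hstep : ∀ t a0, ∫ x, (u t x - Q (x - a0)) ^ 2 ≤ r →
      ∃ a, (∫ x, (u t x - Q (x - a)) ^ 2) + (∫ x, (u1 t x - Q1 (x - a)) ^ 2) ≤ C * D :=
    fun t a0 h0 => hu.step hrM (fun v v1 hv d d1 ho hX h2 h3 =>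
      hst v v1 hv d d1 ho D (hX.trans hrr0) hDd h2 h3) hM hH h0
  obtain ⟨K, hK, hlip⟩ := hu.lip
  have hY : ∀ t a, 0 ≤ ∫ x, (u1 t x - Q1 (x - a)) ^ 2 := fun t a => integral_nonneg fun x => sq_nonneg _
  obtain ⟨τ, hτ, hτK⟩ : ∃ τ > 0, K * τ ≤ r / 2 := by
    refine ⟨r / (2 * (K + 1)), by positivity, ?_⟩
    rw [mul_div_assoc', div_le_iff₀ (by positivity)]
    nlinarith
  have main : ∀ n : ℕ, ∀ t, |t| ≤ n * τ →
      ∃ a, (∫ x, (u t x - Q (x - a)) ^ 2) + (∫ x, (u1 t x - Q1 (x - a)) ^ 2) ≤ C * D := by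
    intro n
    induction n with
    | zero =>
      intro t ht
      have : t = 0 := by
        rw [← abs_nonpos_iff]
        simpa using ht
      subst this
      refine hstep 0 0 ?_
      have h1 : 0 ≤ ∫ x, (u1 0 x - Q1 x) ^ 2 := integral_nonneg fun x => sq_nonneg _
      simp only [sub_zero]
      nlinarith
    | succ n ih =>
      intro t ht
      have hn : (0 : ℝ) < (n : ℝ) + 1 := by positivity
      push_cast at ht
      obtain ⟨s, hs, hst'⟩ : ∃ s, |s| ≤ n * τ ∧ |t - s| ≤ τ := by
        refine ⟨n / (n + 1) * t, ?_, ?_⟩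
        · rw [abs_mul, abs_of_nonneg (by positivity), div_mul_eq_mul_div, div_le_iff₀ hn]
          have : (0 : ℝ) ≤ n := by positivity
          nlinarith
        · have : t - n / (n + 1) * t = t / (n + 1) := by field_simp; ring
          rw [this, abs_div, abs_of_pos hn, div_le_iff₀ hn]
          linarith
      obtain ⟨a, ha⟩ := ih s hs
      refine hstep t a ?_
      have h1 := hlip a s t
      have h2 := hY s a
      have h3 : K * |t - s| ≤ K * τ := mul_le_mul_of_nonneg_left hst' hK
      linarith
  intro t
  obtain ⟨n, hn⟩ := exists_nat_ge (|t| / τ)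
  rw [div_le_iff₀ hτ] at hn
  obtain ⟨a, ha⟩ := main n t hn
  exact ⟨a, ha.trans_lt hDe⟩

open MeasureTheory
open Filter Topology Set

lemma dx_smooth {u : ℝ → ℝ → ℝ} (h : ContDiff ℝ (⊤ : ℕ∞) (fun p : ℝ × ℝ => u p.1 p.2)) :
    ContDiff ℝ (⊤ : ℕ∞) (fun p : ℝ × ℝ => deriv (u p.1) p.2) ∧
      ∀ t x, HasDerivAt (u t) (deriv (u t) x) x := by
  have hF : ∀ t x, HasDerivAt (u t) (fderiv ℝ (fun p : ℝ × ℝ => u p.1 p.2) (t, x) (0, 1)) x := by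
    intro t x
    have h1 : HasFDerivAt (fun p : ℝ × ℝ => u p.1 p.2)
        (fderiv ℝ (fun p : ℝ × ℝ => u p.1 p.2) (t, x)) (t, x) :=
      ((h.differentiable (by simp)) (t, x)).hasFDerivAt
    have h2 : HasDerivAt (fun y : ℝ => (t, y)) ((0 : ℝ), (1 : ℝ)) x :=
      (hasDerivAt_const x t).prodMk (hasDerivAt_id x)
    exact h1.comp_hasDerivAt x h2
  refine ⟨?_, fun t x => (hF t x).differentiableAt.hasDerivAt⟩
  have e : (fun p : ℝ × ℝ => deriv (u p.1) p.2) =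
      fun p => fderiv ℝ (fun p : ℝ × ℝ => u p.1 p.2) p (0, 1) := by
    ext p
    exact (hF p.1 p.2).deriv
  rw [e]
  exact (h.fderiv_right (by simp)).clm_apply contDiff_const

lemma dt_smooth {u : ℝ → ℝ → ℝ} (h : ContDiff ℝ (⊤ : ℕ∞) (fun p : ℝ × ℝ => u p.1 p.2)) (t x : ℝ) :
    HasDerivAt (fun t => u t x) (deriv (fun t => u t x) t) t := by
  have h1 : DifferentiableAt ℝ (fun p : ℝ × ℝ => u p.1 p.2) (t, x) := (h.differentiable (by simp)) (t, x)
  have h2 : DifferentiableAt ℝ (fun s : ℝ => (s, x)) t := by fun_prop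
  exact (DifferentiableAt.comp t h1 h2).hasDerivAt

lemma sol_of {u : ℝ → ℝ → ℝ} (h : ContDiff ℝ (⊤ : ℕ∞) (fun p : ℝ × ℝ => u p.1 p.2))
    (hs : ∀ t : ℝ, ∃ f : SchwartzMap ℝ ℝ, ∀ x : ℝ, u t x = f x)
    (hp : ∀ t x : ℝ, deriv (fun t' => u t' x) t + u t x * deriv (u t) x
          + iteratedDeriv 3 (u t) x = 0) :
    Sol u (fun t => deriv (u t)) (fun t => deriv (deriv (u t))) (fun t => deriv (deriv (deriv (u t)))) := by
  obtain ⟨s1, k0⟩ := dx_smooth h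
  obtain ⟨s2, k1⟩ := dx_smooth (u := fun t => deriv (u t)) s1
  obtain ⟨s3, k2⟩ := dx_smooth (u := fun t => deriv (deriv (u t))) s2
  have i3 : ∀ f : ℝ → ℝ, iteratedDeriv 3 f = deriv (deriv (deriv f)) := fun f => by
    simp [iteratedDeriv_succ, iteratedDeriv_zero]
  have i2 : ∀ f : ℝ → ℝ, iteratedDeriv 2 f = deriv (deriv f) := fun f => by
    simp [iteratedDeriv_succ, iteratedDeriv_zero]
  have hd : ∀ t n, Dec (iteratedDeriv n (u t)) := by
    intro t n
    obtain ⟨f, hf⟩ := hs t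
    rw [funext hf]
    exact dec_schwartz_iter f n
  refine ⟨h.continuous, s1.continuous, s2.continuous, s3.continuous, k0, k1, k2, ?_, ?_, ?_, ?_, ?_⟩
  · intro t x
    refine (dt_smooth h t x).congr_deriv ?_
    have := hp t x
    rw [i3] at this
    linarith
  · intro t
    simpa using hd t 0
  · intro t
    simpa using hd t 1
  · intro t
    simpa [i2] using hd t 2
  · intro t
    simpa [i3] using hd t 3

lemma H1_eq {u u1 u2 u3 : ℝ → ℝ → ℝ} (hu : Sol u u1 u2 u3) (t a : ℝ) :
    H1normSq (fun x => u t x - Q (x - a)) =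
      (∫ x, (u t x - Q (x - a)) ^ 2) + (∫ x, (u1 t x - Q1 (x - a)) ^ 2) := by
  unfold H1normSq
  rw [← integral_add ((hu.e0 t).sub (Q_dec.shift' a)).sq.integrable
    ((hu.e1 t).sub (Q1_dec.shift' a)).sq.integrable]
  congr 1
  ext x
  rw [((hu.d0 t x).fun_sub (deriv_shift Q_deriv a x)).deriv]

/-- Orbital stability of the KdV soliton `Q(x-t)` in `H¹(ℝ)` (Benjamin). -/
theorem kdv_soliton_orbital_stability :
    ∀ ε > (0 : ℝ), ∃ δ > (0 : ℝ), ∀ u : ℝ → ℝ → ℝ,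
      ContDiff ℝ (⊤ : ℕ∞) (fun p : ℝ × ℝ => u p.1 p.2) →
      (∀ t : ℝ, ∃ f : SchwartzMap ℝ ℝ, ∀ x : ℝ, u t x = f x) →
      (∀ t x : ℝ, deriv (fun t' => u t' x) t + u t x * deriv (u t) x
          + iteratedDeriv 3 (u t) x = 0) →
      Real.sqrt (H1normSq (fun x => u 0 x - Q x)) < δ →
      ∀ t : ℝ, ∃ a : ℝ,
        Real.sqrt (H1normSq (fun x => u t x - Q (x - a))) < ε := by
  intro ε hε
  obtain ⟨δ, hδ, H⟩ := Sol_stab ε hε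
  refine ⟨δ, hδ, fun u h hs hp h0 t => ?_⟩
  have hu := sol_of h hs hp
  have e0 := H1_eq hu 0 0
  simp only [sub_zero] at e0
  rw [Real.sqrt_lt' hδ, e0] at h0
  obtain ⟨a, ha⟩ := H _ _ _ _ hu h0.le t
  exact ⟨a, by rw [Real.sqrt_lt' hε, H1_eq hu]; exact ha⟩
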